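/- There exist universal constants c, C > 0 with the following property. Let n ≥ 1 and let S ⊆ ℝ^n be a Borel set with S ∩ (−S) = ∅ and 0 < Vol_n(S) ≤ n/30. Let μ be any SL_n(ℝ)-invariant Borel probability measure on the space 𝒳_n of covolume-one lattices in ℝ^n. Then μ({L ∈ 𝒳_n : L ∩ S is finite, |L ∩ S| ≤ n/10, and the vectors of L ∩ S are linearly independent}) ≥ 1 − C·e^{−c·n}. -/

import Mathlib

open MeasureTheory Pointwise
open scoped ENNReal

noncomputable section

/-- `SL(n, ℝ)`, the special linear group of `n × n` real matrices of determinant one. -/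
abbrev SLR (n : ℕ) := Matrix.SpecialLinearGroup (Fin n) ℝ

/-- The topology on `SL(n, ℝ)` induced from the space of matrices. -/
instance (n : ℕ) : TopologicalSpace (SLR n) :=
  TopologicalSpace.induced (fun g => (g : Matrix (Fin n) (Fin n) ℝ)) inferInstance

/-- The subgroup `SL(n, ℤ)` of `SL(n, ℝ)` (the range of the coefficient-wise
integer-to-real map on special linear groups). -/
def SLZ (n : ℕ) : Subgroup (SLR n) :=
  MonoidHom.range (Matrix.SpecialLinearGroup.map (n := Fin n) (Int.castRingHom ℝ))

/-- The space `𝒳ₙ = SL(n, ℝ) / SL(n, ℤ)` of lattices of covolume one in `ℝⁿ`. -/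
def LatticeSpace (n : ℕ) := SLR n ⧸ SLZ n

instance (n : ℕ) : TopologicalSpace (LatticeSpace n) :=
  inferInstanceAs (TopologicalSpace (SLR n ⧸ SLZ n))

/-- The Borel σ-algebra on the space of lattices. -/
instance (n : ℕ) : MeasurableSpace (LatticeSpace n) := borel _

/-- The action of `SL(n, ℝ)` on the space of lattices, `g.L = {g x : x ∈ L}`. -/
instance (n : ℕ) : MulAction (SLR n) (LatticeSpace n) :=
  inferInstanceAs (MulAction (SLR n) (SLR n ⧸ SLZ n))

/-- The lattice `{g v : v ∈ ℤⁿ} ⊆ ℝⁿ` associated to a point of `LatticeSpace n`,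
computed via a representative `g` of the coset (the resulting set of vectors does not
depend on the choice of representative, since `SL(n, ℤ)` preserves `ℤⁿ`). -/
def latticeOf {n : ℕ} (L : LatticeSpace n) : Set (Fin n → ℝ) :=
  {y | ∃ v : Fin n → ℤ,
    y = (Quotient.out (α := SLR n) L).1.mulVec (fun i => (v i : ℝ))}

/-- A set `X ⊆ ℝⁿ` consists of linearly independent vectors. -/
def indepSet {n : ℕ} (X : Set (Fin n → ℝ)) : Prop :=
  LinearIndependent ℝ (fun x : X => (x : Fin n → ℝ))

open Topology

theorem QuotientGroup.apply_out_mk {G β : Type*} [Group G] {Γ : Subgroup G} {f : G → β}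
    (hf : ∀ g, ∀ γ ∈ Γ, f (g * γ) = f g) (g : G) : f (Quotient.out (g : G ⧸ Γ)) = f g := by
  obtain ⟨h, hh⟩ := QuotientGroup.mk_out_eq_mul Γ g
  rw [hh, hf _ _ h.2]

section Quotient

theorem tsum_apply_mul_mul {G : Type*} [Group G] {Γ : Subgroup G} (f : G → ℝ≥0∞) (g : G) (γ : G) (hγ : γ ∈ Γ) :
    ∑' δ : Γ, f (g * γ * δ) = ∑' δ : Γ, f (g * δ) := by
  rw [← (Equiv.mulLeft (⟨γ, hγ⟩ : Γ)).tsum_eq (fun δ : Γ => f (g * δ))]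
  simp [mul_assoc]

variable {G : Type*} [Group G] [MeasurableSpace G] {Γ : Subgroup G}

/-- The counting measure on the fibre over a point of `G ⧸ Γ`. -/
def fibreMeasure (x : G ⧸ Γ) : Measure G :=
  Measure.sum fun γ : Γ => Measure.dirac (x.out * γ)

theorem lintegral_fibreMeasure (x : G ⧸ Γ) {f : G → ℝ≥0∞} (hf : Measurable f) :
    ∫⁻ g, f g ∂fibreMeasure x = ∑' γ : Γ, f (x.out * γ) := by
  rw [fibreMeasure, lintegral_sum_measure]
  congr 1 with γ
  rw [lintegral_dirac' _ hf]

variable [MeasurableSpace (G ⧸ Γ)]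

theorem measurable_apply_out {β : Type*} [MeasurableSpace β]
    (hmk : ∀ E : Set (G ⧸ Γ), MeasurableSet E ↔
      MeasurableSet ((QuotientGroup.mk : G → G ⧸ Γ) ⁻¹' E))
    {f : G → β} (hf : Measurable f) (hinv : ∀ g, ∀ γ ∈ Γ, f (g * γ) = f g) :
    Measurable (fun x : G ⧸ Γ => f x.out) := by
  intro E hE
  rw [hmk]
  have : (QuotientGroup.mk : G → G ⧸ Γ) ⁻¹' ((fun x : G ⧸ Γ => f x.out) ⁻¹' E) = f ⁻¹' E := by
    ext g
    simp only [Set.mem_preimage, QuotientGroup.apply_out_mk hinv]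
  rw [this]
  exact hf hE

variable [MeasurableMul₂ G]

theorem measurable_smul_of_mk
    (hmk : ∀ E : Set (G ⧸ Γ), MeasurableSet E ↔
      MeasurableSet ((QuotientGroup.mk : G → G ⧸ Γ) ⁻¹' E))
    (g : G) : Measurable fun x : G ⧸ Γ => g • x := by
  intro E hE
  rw [hmk] at hE ⊢
  exact (measurable_const_mul g) hE

variable [Countable Γ]

theorem measurable_fibreMeasure
    (hmk : ∀ E : Set (G ⧸ Γ), MeasurableSet E ↔
      MeasurableSet ((QuotientGroup.mk : G → G ⧸ Γ) ⁻¹' E)) :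
    Measurable (fibreMeasure : G ⧸ Γ → Measure G) := by
  refine Measure.measurable_of_measurable_coe _ fun E hE => ?_
  have h1 : Measurable (E.indicator (1 : G → ℝ≥0∞)) := measurable_one.indicator hE
  have : (fun x : G ⧸ Γ => fibreMeasure x E) =
      fun x : G ⧸ Γ => (fun g => ∑' γ : Γ, E.indicator (1 : G → ℝ≥0∞) (g * γ)) x.out := by
    ext x
    rw [← lintegral_indicator_one hE, lintegral_fibreMeasure x h1]
  rw [this]
  refine measurable_apply_out (f := fun g => ∑' γ : Γ, E.indicator (1 : G → ℝ≥0∞) (g * γ)) hmk ?_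
    fun g γ hγ => tsum_apply_mul_mul _ g γ hγ
  exact Measurable.tsum fun γ => h1.comp (measurable_mul_const _)

theorem lintegral_bind_fibreMeasure
    (hmk : ∀ E : Set (G ⧸ Γ), MeasurableSet E ↔
      MeasurableSet ((QuotientGroup.mk : G → G ⧸ Γ) ⁻¹' E))
    (μ : Measure (G ⧸ Γ)) {f : G → ℝ≥0∞} (hf : Measurable f) :
    ∫⁻ g, f g ∂μ.bind fibreMeasure = ∫⁻ x, ∑' γ : Γ, f (x.out * γ) ∂μ := by
  rw [Measure.lintegral_bind (measurable_fibreMeasure hmk).aemeasurable hf.aemeasurable]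
  simp_rw [fun x : G ⧸ Γ => lintegral_fibreMeasure x hf]

theorem isMulLeftInvariant_bind_fibreMeasure
    (hmk : ∀ E : Set (G ⧸ Γ), MeasurableSet E ↔
      MeasurableSet ((QuotientGroup.mk : G → G ⧸ Γ) ⁻¹' E))
    (μ : Measure (G ⧸ Γ)) (hμ : ∀ g : G, Measure.map (fun x => g • x) μ = μ) :
    (μ.bind fibreMeasure).IsMulLeftInvariant := by
  refine ⟨fun g => Measure.ext_of_lintegral _ fun f hf => ?_⟩
  rw [lintegral_map hf (measurable_const_mul g),
    lintegral_bind_fibreMeasure hmk μ (f := fun a => f (g * a)) (hf.comp (measurable_const_mul g)),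
    lintegral_bind_fibreMeasure hmk μ hf]
  have hm : Measurable fun x : G ⧸ Γ => ∑' γ : Γ, f (x.out * γ) :=
    measurable_apply_out (f := fun g => ∑' γ : Γ, f (g * γ)) hmk
      (Measurable.tsum fun γ => hf.comp (measurable_mul_const _))
      fun g γ hγ => tsum_apply_mul_mul _ g γ hγ
  conv_rhs => rw [← hμ g, lintegral_map hm (measurable_smul_of_mk hmk g)]
  congr 1 with x
  induction x using QuotientGroup.induction_on with
  | H h =>
  have h1 := QuotientGroup.apply_out_mk (Γ := Γ) (f := fun h => ∑' γ : Γ, f (h * γ))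
    (fun g γ hγ => tsum_apply_mul_mul f g γ hγ) (g * h)
  have h2 := QuotientGroup.apply_out_mk (Γ := Γ) (f := fun h => ∑' γ : Γ, f (g * h * γ))
    (fun k γ hγ => by simpa only [mul_assoc] using tsum_apply_mul_mul (Γ := Γ) f (g * k) γ hγ) h
  simp only [mul_assoc] at h1 h2 ⊢
  exact h2.trans h1.symm

end Quotient

section Uniqueness

variable {G : Type*} [Group G] [TopologicalSpace G] [IsTopologicalGroup G]
  {Γ : Subgroup G}

theorem exists_tsum_indicator_le
    (hΓ : ∀ K : Set G, IsCompact K → (K ∩ Γ).Finite) {K : Set G} (hK : IsCompact K) :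
    ∃ N : ℕ, ∀ g : G, ∑' γ : Γ, K.indicator (1 : G → ℝ≥0∞) (g * γ) ≤ N := by
  have hfin := hΓ (K⁻¹ * K) (hK.inv.mul hK)
  refine ⟨(K⁻¹ * K ∩ Γ).ncard, fun g => ?_⟩
  by_cases h : ∃ γ₀ : Γ, g * γ₀ ∈ K
  · obtain ⟨γ₀, h₀⟩ := h
    rw [← tsum_apply_mul_mul _ g γ₀ γ₀.2]
    have hs : (Function.support fun γ : Γ => K.indicator (1 : G → ℝ≥0∞) (g * γ₀ * γ)) ⊆
        ((↑) : Γ → G) ⁻¹' (K⁻¹ * K ∩ Γ) := by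
      intro γ hγ
      have h1 : g * γ₀ * γ ∈ K := by
        by_contra h
        exact hγ (Set.indicator_of_notMem h _)
      refine ⟨?_, γ.2⟩
      have := Set.mul_mem_mul (Set.inv_mem_inv.2 h₀) h1
      rwa [show (g * γ₀ : G)⁻¹ * (g * γ₀ * γ) = γ by group] at this
    have hfin' : (((↑) : Γ → G) ⁻¹' (K⁻¹ * K ∩ Γ)).Finite :=
      hfin.preimage Subtype.val_injective.injOn
    rw [tsum_eq_sum (s := hfin'.toFinset) fun γ hγ => by
      by_contra h
      exact hγ (hfin'.mem_toFinset.2 (hs h))]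
    calc ∑ γ ∈ hfin'.toFinset, K.indicator (1 : G → ℝ≥0∞) (g * γ₀ * γ)
        ≤ ∑ γ ∈ hfin'.toFinset, (1 : ℝ≥0∞) :=
          Finset.sum_le_sum fun γ _ => Set.indicator_le_self' (by simp) _
      _ = ((((↑) : Γ → G) ⁻¹' (K⁻¹ * K ∩ Γ)).ncard : ℝ≥0∞) := by
          rw [Finset.sum_const, nsmul_one, Set.ncard_eq_toFinset_card _ hfin']
      _ = ((K⁻¹ * K ∩ Γ).ncard : ℝ≥0∞) := by
          rw [Set.ncard_preimage_of_injective_subset_range Subtype.val_injective]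
          rintro x ⟨-, hx⟩
          exact ⟨⟨x, hx⟩, rfl⟩
  · push Not at h
    simp [h]

variable [SecondCountableTopology G] [T2Space G] [MeasurableSpace G] [BorelSpace G]

theorem exists_weight [LocallyCompactSpace G] (hΓ : ∀ K : Set G, IsCompact K → (K ∩ Γ).Finite) :
    ∃ w : G → ℝ≥0∞, Measurable w ∧ ∀ g, ∑' γ : Γ, w (g * γ) ≠ 0 ∧ ∑' γ : Γ, w (g * γ) ≠ ∞ := by
  choose N hN using fun i => exists_tsum_indicator_le hΓ (isCompact_compactCovering G i)
  obtain ⟨ε, hε, hs⟩ := ENNReal.exists_pos_tsum_mul_lt_of_countable one_ne_zero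
    (fun i => (N i : ℝ≥0∞)) fun i => ENNReal.natCast_ne_top _
  let K := compactCovering G
  have hKm i : MeasurableSet (K i) := (isCompact_compactCovering G i).isClosed.measurableSet
  refine ⟨fun g => ∑' i, ε i * (K i).indicator 1 g, ?_, fun g => ⟨?_, ?_⟩⟩
  · exact Measurable.tsum fun i => (measurable_one.indicator (hKm i)).const_mul _
  · obtain ⟨i, hi⟩ := Set.mem_iUnion.1 ((iUnion_compactCovering G).symm ▸ Set.mem_univ g)
    intro h0
    have h1 := ENNReal.tsum_eq_zero.1 h0 1
    have h2 := ENNReal.tsum_eq_zero.1 h1 i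
    have h3 : (K i).indicator (1 : G → ℝ≥0∞) g = 1 := Set.indicator_of_mem hi _
    simp [h3, (hε i).ne'] at h2
  · rw [ENNReal.tsum_comm]
    refine (lt_of_le_of_lt (ENNReal.tsum_le_tsum fun i => ?_) (hs.trans ENNReal.one_lt_top)).ne
    rw [ENNReal.tsum_mul_left, mul_comm]
    gcongr
    exact hN i g

variable [Countable Γ] [MeasurableSpace (G ⧸ Γ)]

theorem isFiniteMeasureOnCompacts_bind_fibreMeasure
    (hΓ : ∀ K : Set G, IsCompact K → (K ∩ Γ).Finite)
    (hmk : ∀ E : Set (G ⧸ Γ), MeasurableSet E ↔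
      MeasurableSet ((QuotientGroup.mk : G → G ⧸ Γ) ⁻¹' E))
    (μ : Measure (G ⧸ Γ)) [IsFiniteMeasure μ] :
    IsFiniteMeasureOnCompacts (μ.bind fibreMeasure) := by
  refine ⟨fun {K} hK => ?_⟩
  obtain ⟨N, hN⟩ := exists_tsum_indicator_le hΓ hK
  have hm := hK.isClosed.measurableSet
  rw [← lintegral_indicator_one hm,
    lintegral_bind_fibreMeasure hmk μ (measurable_one.indicator hm)]
  calc _ ≤ ∫⁻ _, (N : ℝ≥0∞) ∂μ := lintegral_mono fun x => hN _
    _ < ∞ := by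
      rw [lintegral_const]
      exact ENNReal.mul_lt_top (ENNReal.natCast_lt_top N) (measure_lt_top μ _)

variable [LocallyCompactSpace G]

/-- An invariant probability measure on the quotient of a locally compact group by a discrete
subgroup is unique. -/
theorem eq_of_isMulLeftInvariant_quotient
    (hΓ : ∀ K : Set G, IsCompact K → (K ∩ Γ).Finite)
    (hmk : ∀ E : Set (G ⧸ Γ), MeasurableSet E ↔
      MeasurableSet ((QuotientGroup.mk : G → G ⧸ Γ) ⁻¹' E))
    (μ μ' : Measure (G ⧸ Γ)) [IsProbabilityMeasure μ] [IsProbabilityMeasure μ']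
    (hμ : ∀ g : G, Measure.map (fun x => g • x) μ = μ)
    (hμ' : ∀ g : G, Measure.map (fun x => g • x) μ' = μ') : μ = μ' := by
  obtain ⟨w, hw, hw'⟩ := exists_weight hΓ
  have hmk' : Measurable (QuotientGroup.mk : G → G ⧸ Γ) := fun E hE => (hmk E).1 hE
  let h : G ⧸ Γ → ℝ≥0∞ := fun x => ∑' γ : Γ, w (x.out * γ)
  have hh : Measurable h :=
    measurable_apply_out (f := fun g => ∑' γ : Γ, w (g * γ)) hmk
      (Measurable.tsum fun γ => hw.comp (measurable_mul_const _))
      fun g γ hγ => tsum_apply_mul_mul _ g γ hγ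
  have key (ν : Measure (G ⧸ Γ)) [IsProbabilityMeasure ν]
      (hν : ∀ g : G, Measure.map (fun x => g • x) ν = ν) :
      ∃ c : ℝ≥0∞, c ≠ ∞ ∧ ∀ F : G ⧸ Γ → ℝ≥0∞, Measurable F →
        ∫⁻ x, F x ∂ν = c * ∫⁻ g, w g * ((h g)⁻¹ * F g) ∂Measure.haar := by
    have i1 := isMulLeftInvariant_bind_fibreMeasure hmk ν hν
    have i2 := isFiniteMeasureOnCompacts_bind_fibreMeasure hΓ hmk ν
    have h1 := Measure.isMulLeftInvariant_eq_smul (ν.bind fibreMeasure) (Measure.haar (G := G))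
    refine ⟨_, ENNReal.coe_ne_top (r := (ν.bind fibreMeasure).haarScalarFactor Measure.haar),
      fun F hF => ?_⟩
    have hm : Measurable fun g : G => w g * ((h g)⁻¹ * F g) :=
      hw.mul ((hh.inv.mul hF).comp hmk')
    have h2 := lintegral_bind_fibreMeasure hmk ν hm
    rw [h1, lintegral_smul_measure] at h2
    rw [← smul_eq_mul, ← ENNReal.smul_def, h2]
    congr 1 with x
    have : ∀ γ : Γ, ((x.out * γ : G) : G ⧸ Γ) = x := fun γ => by
      rw [QuotientGroup.mk_mul_of_mem _ γ.2, QuotientGroup.out_eq']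
    simp_rw [this, ENNReal.tsum_mul_right]
    change F x = h x * _
    rw [← mul_assoc, ENNReal.mul_inv_cancel (hw' _).1 (hw' _).2, one_mul]
  obtain ⟨c, hc, h1⟩ := key μ hμ
  obtain ⟨c', hc', h1'⟩ := key μ' hμ'
  have e := h1 1 measurable_one
  have e' := h1' 1 measurable_one
  simp only [Pi.one_apply, lintegral_one, measure_univ] at e e'
  have hcc : c = c' := by
    rw [ENNReal.eq_inv_of_mul_eq_one_left e.symm, ENNReal.eq_inv_of_mul_eq_one_left e'.symm]
  refine Measure.ext_of_lintegral _ fun F hF => ?_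
  rw [h1 F hF, h1' F hF, hcc]

end Uniqueness

instance (n : ℕ) : IsTopologicalGroup (SLR n) :=
  Matrix.SpecialLinearGroup.topologicalGroup (n := Fin n) (R := ℝ)

theorem isClosedEmbedding_SLR_val (n : ℕ) :
    IsClosedEmbedding fun g : SLR n => (g : Matrix (Fin n) (Fin n) ℝ) :=
  Matrix.SpecialLinearGroup.isClosedEmbedding_val (n := Fin n) (R := ℝ)

instance (n : ℕ) : SecondCountableTopology (Matrix (Fin n) (Fin n) ℝ) :=
  inferInstanceAs (SecondCountableTopology (Fin n → Fin n → ℝ))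

instance (n : ℕ) : LocallyCompactSpace (Matrix (Fin n) (Fin n) ℝ) :=
  inferInstanceAs (LocallyCompactSpace (Fin n → Fin n → ℝ))

instance (n : ℕ) : PolishSpace (Matrix (Fin n) (Fin n) ℝ) :=
  inferInstanceAs (PolishSpace (Fin n → Fin n → ℝ))

instance (n : ℕ) : LocallyCompactSpace (SLR n) :=
  (isClosedEmbedding_SLR_val n).locallyCompactSpace

instance (n : ℕ) : PolishSpace (SLR n) := (isClosedEmbedding_SLR_val n).polishSpace

instance (n : ℕ) : MeasurableSpace (SLR n) := borel _

instance (n : ℕ) : BorelSpace (SLR n) := ⟨rfl⟩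

instance (n : ℕ) : BorelSpace (LatticeSpace n) := ⟨rfl⟩

theorem isClosedEmbedding_map_intCast (n : ℕ) :
    IsClosedEmbedding (Matrix.SpecialLinearGroup.map (n := Fin n) (Int.castRingHom ℝ)) :=
  Topology.IsClosedEmbedding.specialLinearGroup_map (n := Fin n) (f := Int.castRingHom ℝ)
    Int.isClosedEmbedding_coe_real

instance (n : ℕ) : Countable (SLZ n) := by
  have : Countable (Matrix.SpecialLinearGroup (Fin n) ℤ) :=
    inferInstanceAs (Countable {A : Fin n → Fin n → ℤ // Matrix.det A = 1})
  exact Set.countable_range _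

theorem IsCompact.finite_inter_SLZ {n : ℕ} {K : Set (SLR n)} (hK : IsCompact K) :
    (K ∩ SLZ n).Finite := by
  have h := (isClosedEmbedding_map_intCast n).isCompact_preimage hK
  have h2 := h.finite_of_discrete.image (Matrix.SpecialLinearGroup.map (n := Fin n) (Int.castRingHom ℝ))
  rwa [Set.image_preimage_eq_inter_range] at h2

theorem measurableSet_latticeSpace_iff {n : ℕ} (E : Set (LatticeSpace n)) :
    MeasurableSet E ↔
      MeasurableSet ((fun g : SLR n => ((g : SLR n ⧸ SLZ n) : LatticeSpace n)) ⁻¹' E) := by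
  have hcl : IsClosed (SLZ n : Set (SLR n)) := (isClosedEmbedding_map_intCast n).isClosed_range
  have h1 : T1Space (SLR n ⧸ SLZ n) := QuotientGroup.t1Space_iff.2 hcl
  have h2 : SecondCountableTopology (SLR n ⧸ SLZ n) := inferInstance
  have h3 := (QuotientGroup.continuous_mk (G := SLR n) (N := SLZ n)).map_borel_eq
    QuotientGroup.mk_surjective
  exact (congrArg (fun m : MeasurableSpace (SLR n ⧸ SLZ n) => MeasurableSet[m] E) h3.symm).to_iff

section Average

variable {G : Type*} [Group G] {Γ : Subgroup G} {ι : Type*} [Fintype ι]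

theorem sum_apply_mul_mul {δ : ι → G} {β : Type*} [AddCommMonoid β]
    (hδ : ∀ γ ∈ Γ, ∃ e : ι ≃ ι, ∀ a, ((γ * δ a : G) : G ⧸ Γ) = δ (e a))
    (F : G ⧸ Γ → β) (g γ : G) (hγ : γ ∈ Γ) :
    ∑ a, F ((g * γ * δ a : G) : G ⧸ Γ) = ∑ a, F ((g * δ a : G) : G ⧸ Γ) := by
  obtain ⟨e, he⟩ := hδ γ hγ
  rw [← e.sum_comp fun a => F ((g * δ a : G) : G ⧸ Γ)]
  refine Finset.sum_congr rfl fun a _ => ?_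
  have h := congrArg (fun x : G ⧸ Γ => g • x) (he a)
  rw [mul_assoc]
  exact congrArg F h

variable [MeasurableSpace (G ⧸ Γ)]

/-- The uniform probability measure on the points `x δ_a` of `G ⧸ Γ`. -/
def averageMeasure (δ : ι → G) (x : G ⧸ Γ) : Measure (G ⧸ Γ) :=
  (Fintype.card ι : ℝ≥0∞)⁻¹ • ∑ a, Measure.dirac ((x.out * δ a : G) : G ⧸ Γ)

theorem lintegral_averageMeasure (δ : ι → G) (x : G ⧸ Γ) {F : G ⧸ Γ → ℝ≥0∞} (hF : Measurable F) :
    ∫⁻ y, F y ∂averageMeasure δ x =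
      (Fintype.card ι : ℝ≥0∞)⁻¹ * ∑ a, F ((x.out * δ a : G) : G ⧸ Γ) := by
  rw [averageMeasure, lintegral_smul_measure, lintegral_finsetSum_measure, smul_eq_mul]
  simp_rw [lintegral_dirac' _ hF]

variable [MeasurableSpace G] [MeasurableMul₂ G]

theorem measurable_averageMeasure
    (hmk : ∀ E : Set (G ⧸ Γ), MeasurableSet E ↔
      MeasurableSet ((QuotientGroup.mk : G → G ⧸ Γ) ⁻¹' E))
    {δ : ι → G} (hδ : ∀ γ ∈ Γ, ∃ e : ι ≃ ι, ∀ a, ((γ * δ a : G) : G ⧸ Γ) = δ (e a)) :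
    Measurable (averageMeasure δ : G ⧸ Γ → Measure (G ⧸ Γ)) := by
  refine Measure.measurable_of_measurable_coe _ fun E hE => ?_
  have h1 : Measurable (E.indicator (1 : G ⧸ Γ → ℝ≥0∞)) := measurable_one.indicator hE
  simp_rw [fun x : G ⧸ Γ => (lintegral_indicator_one (μ := averageMeasure δ x) hE).symm,
    lintegral_averageMeasure δ _ h1]
  refine (measurable_apply_out (f := fun g => ∑ a, E.indicator (1 : G ⧸ Γ → ℝ≥0∞)
    ((g * δ a : G) : G ⧸ Γ)) hmk ?_ fun g γ hγ => sum_apply_mul_mul hδ _ g γ hγ).const_mul _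
  have hmk' : Measurable (QuotientGroup.mk : G → G ⧸ Γ) := fun E hE => (hmk E).1 hE
  exact Finset.measurable_sum _ fun a _ => h1.comp (hmk'.comp (measurable_mul_const _))

theorem map_smul_bind_averageMeasure
    (hmk : ∀ E : Set (G ⧸ Γ), MeasurableSet E ↔
      MeasurableSet ((QuotientGroup.mk : G → G ⧸ Γ) ⁻¹' E))
    {δ : ι → G} (hδ : ∀ γ ∈ Γ, ∃ e : ι ≃ ι, ∀ a, ((γ * δ a : G) : G ⧸ Γ) = δ (e a))
    (μ : Measure (G ⧸ Γ)) (hμ : ∀ g : G, Measure.map (fun x => g • x) μ = μ) (g : G) :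
    Measure.map (fun x => g • x) (μ.bind (averageMeasure δ)) = μ.bind (averageMeasure δ) := by
  have hκ := measurable_averageMeasure hmk hδ
  have hg := measurable_smul_of_mk hmk g
  have hmk' : Measurable (QuotientGroup.mk : G → G ⧸ Γ) := fun E hE => (hmk E).1 hE
  refine Measure.ext_of_lintegral _ fun F hF => ?_
  rw [lintegral_map hF hg, Measure.lintegral_bind hκ.aemeasurable (f := fun x => F (g • x)) (hF.comp hg).aemeasurable,
    Measure.lintegral_bind hκ.aemeasurable hF.aemeasurable]
  have hm : Measurable fun x => ∫⁻ y, F y ∂averageMeasure δ x :=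
    (Measure.measurable_lintegral hF).comp hκ
  conv_rhs => rw [← hμ g, lintegral_map hm hg]
  congr 1 with x
  rw [lintegral_averageMeasure _ _ hF, lintegral_averageMeasure _ _ (F := fun x => F (g • x)) (hF.comp hg)]
  congr 1
  induction x using QuotientGroup.induction_on with
  | H h =>
  have h1 := QuotientGroup.apply_out_mk (Γ := Γ) (f := fun h => ∑ a, F ((h * δ a : G) : G ⧸ Γ))
    (fun k γ hγ => sum_apply_mul_mul hδ F k γ hγ) (g * h)
  have h2 := QuotientGroup.apply_out_mk (Γ := Γ)
    (f := fun h => ∑ a, F (g • ((h * δ a : G) : G ⧸ Γ)))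
    (fun k γ hγ => sum_apply_mul_mul hδ (fun x => F (g • x)) k γ hγ) h
  refine h2.trans (Eq.trans ?_ h1.symm)
  simp only [mul_assoc]
  rfl

theorem isProbabilityMeasure_bind_averageMeasure [Nonempty ι]
    (hmk : ∀ E : Set (G ⧸ Γ), MeasurableSet E ↔
      MeasurableSet ((QuotientGroup.mk : G → G ⧸ Γ) ⁻¹' E))
    {δ : ι → G} (hδ : ∀ γ ∈ Γ, ∃ e : ι ≃ ι, ∀ a, ((γ * δ a : G) : G ⧸ Γ) = δ (e a))
    (μ : Measure (G ⧸ Γ)) [IsProbabilityMeasure μ] :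
    IsProbabilityMeasure (μ.bind (averageMeasure δ)) := by
  refine ⟨?_⟩
  rw [Measure.bind_apply .univ (measurable_averageMeasure hmk hδ).aemeasurable]
  have (x : G ⧸ Γ) : averageMeasure δ x Set.univ = 1 := by
    simp [averageMeasure, ENNReal.inv_mul_cancel]
  simp [this]

end Average

theorem lintegral_out_eq_lintegral_average {G : Type*} [Group G] [TopologicalSpace G]
    [IsTopologicalGroup G] [LocallyCompactSpace G] [SecondCountableTopology G] [T2Space G]
    [MeasurableSpace G] [BorelSpace G] {Γ : Subgroup G} [Countable Γ] [MeasurableSpace (G ⧸ Γ)]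
    (hΓ : ∀ K : Set G, IsCompact K → (K ∩ Γ).Finite)
    (hmk : ∀ E : Set (G ⧸ Γ), MeasurableSet E ↔
      MeasurableSet ((QuotientGroup.mk : G → G ⧸ Γ) ⁻¹' E))
    {ι : Type*} [Fintype ι] [Nonempty ι] {δ : ι → G}
    (hδ : ∀ γ ∈ Γ, ∃ e : ι ≃ ι, ∀ a, ((γ * δ a : G) : G ⧸ Γ) = δ (e a))
    (μ : Measure (G ⧸ Γ)) [IsProbabilityMeasure μ]
    (hμ : ∀ g : G, Measure.map (fun x => g • x) μ = μ)
    {f : G → ℝ≥0∞} (hf : Measurable f) (hinv : ∀ g, ∀ γ ∈ Γ, f (g * γ) = f g) :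
    ∫⁻ x, f x.out ∂μ = ∫⁻ x, (Fintype.card ι : ℝ≥0∞)⁻¹ * ∑ a, f (x.out * δ a) ∂μ := by
  have := isProbabilityMeasure_bind_averageMeasure hmk hδ μ
  have hF : Measurable fun x : G ⧸ Γ => f x.out := measurable_apply_out hmk hf hinv
  conv_lhs => rw [eq_of_isMulLeftInvariant_quotient hΓ hmk μ _ hμ
    (map_smul_bind_averageMeasure hmk hδ μ hμ)]
  rw [Measure.lintegral_bind (measurable_averageMeasure hmk hδ).aemeasurable hF.aemeasurable]
  simp_rw [fun x : G ⧸ Γ => lintegral_averageMeasure δ x hF, QuotientGroup.apply_out_mk hinv]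

/-- An invariant probability measure on the space of lattices is preserved by averaging over a
finite family `δ` which is permuted by `SL(n, ℤ)`. -/
theorem lintegral_eq_lintegral_average {n : ℕ} {ι : Type*} [Fintype ι] [Nonempty ι]
    {δ : ι → SLR n}
    (hδ : ∀ γ ∈ SLZ n, ∃ e : ι ≃ ι, ∀ a, ((γ * δ a : SLR n) : SLR n ⧸ SLZ n) = δ (e a))
    (μ : Measure (LatticeSpace n)) [IsProbabilityMeasure μ]
    (hμ : ∀ g : SLR n, Measure.map (fun x => g • x) μ = μ)
    {f : SLR n → ℝ≥0∞} (hf : Measurable f) (hinv : ∀ g, ∀ γ ∈ SLZ n, f (g * γ) = f g) :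
    ∫⁻ x, f (Quotient.out (α := SLR n) x) ∂μ =
      ∫⁻ x, (Fintype.card ι : ℝ≥0∞)⁻¹ * ∑ a, f (Quotient.out (α := SLR n) x * δ a) ∂μ :=
  @lintegral_out_eq_lintegral_average (SLR n) _ _ _ _ _ _ _ _ (SLZ n) _ (borel _)
    (fun _ hK => hK.finite_inter_SLZ) measurableSet_latticeSpace_iff ι _ _ δ hδ μ ‹_› hμ f hf hinv

theorem measurable_latticeSpace_out {n : ℕ} {f : SLR n → ℝ≥0∞} (hf : Measurable f)
    (hinv : ∀ g, ∀ γ ∈ SLZ n, f (g * γ) = f g) :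
    Measurable fun x : LatticeSpace n => f (Quotient.out (α := SLR n) x) :=
  @measurable_apply_out (SLR n) _ _ (SLZ n) (borel _) _ _ measurableSet_latticeSpace_iff f hf hinv

open Matrix in
/-- The sublattice of `ℤⁿ` cut out by one nonzero linear equation modulo `P` has a basis whose
matrix has determinant `P`. -/
theorem exists_matrix_range_eq_ker {n P : ℕ} [Fact P.Prime] (a : Fin n → ZMod P) (ha : a ≠ 0) :
    ∃ M : Matrix (Fin n) (Fin n) ℤ, M.det = P ∧
      ∀ u : Fin n → ℤ, (∃ v, M *ᵥ v = u) ↔ ∑ i, a i * (u i : ZMod P) = 0 := by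
  obtain ⟨i, hi⟩ := Function.ne_iff.1 ha
  simp only [Pi.zero_apply] at hi
  choose c hc using fun j => ZMod.intCast_surjective (a j / a i)
  refine ⟨updateRow 1 i fun j => if j = i then (P : ℤ) else -c j, ?_, fun u => ?_⟩
  · rw [← cramer_transpose_apply]
    simp
  · have hrow (v : Fin n → ℤ) : (updateRow (1 : Matrix (Fin n) (Fin n) ℤ) i
        (fun j => if j = i then (P : ℤ) else -c j)) *ᵥ v =
        Function.update v i (P * v i - ∑ j ∈ Finset.univ.erase i, c j * v j) := by
      ext k
      by_cases hk : k = i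
      · subst hk
        rw [Function.update_self, mulVec, updateRow_self, dotProduct,
          ← Finset.add_sum_erase _ _ (Finset.mem_univ k), if_pos rfl, sub_eq_add_neg,
          ← Finset.sum_neg_distrib]
        congr 1
        refine Finset.sum_congr rfl fun j hj => ?_
        rw [if_neg (Finset.ne_of_mem_erase hj), neg_mul]
      · rw [Function.update_of_ne hk, mulVec, updateRow_ne hk]
        exact congrFun (one_mulVec v) k
    have hsum : ∑ j, a j * (u j : ZMod P) =
        a i * ((u i + ∑ j ∈ Finset.univ.erase i, c j * u j : ℤ) : ZMod P) := by
      rw [← Finset.add_sum_erase _ _ (Finset.mem_univ i)]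
      push_cast
      rw [mul_add, Finset.mul_sum]
      congr 1
      refine Finset.sum_congr rfl fun j _ => ?_
      rw [hc]
      field_simp
    rw [hsum, mul_eq_zero, or_iff_right hi, ZMod.intCast_zmod_eq_zero_iff_dvd]
    constructor
    · rintro ⟨v, rfl⟩
      rw [hrow]
      refine ⟨v i, ?_⟩
      rw [Function.update_self]
      have : ∑ j ∈ Finset.univ.erase i, c j * Function.update v i
          (P * v i - ∑ j ∈ Finset.univ.erase i, c j * v j) j =
          ∑ j ∈ Finset.univ.erase i, c j * v j :=
        Finset.sum_congr rfl fun j hj => by rw [Function.update_of_ne (Finset.ne_of_mem_erase hj)]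
      rw [this]
      ring
    · rintro ⟨k, hk⟩
      refine ⟨Function.update u i k, ?_⟩
      rw [hrow]
      have : ∑ j ∈ Finset.univ.erase i, c j * Function.update u i k j =
          ∑ j ∈ Finset.univ.erase i, c j * u j :=
        Finset.sum_congr rfl fun j hj => by rw [Function.update_of_ne (Finset.ne_of_mem_erase hj)]
      rw [this, Function.update_self, Function.update_idem, ← hk]
      simp

open Matrix in
/-- Hecke points: for every nonzero linear form modulo `P` there is an element of `SL(n, ℝ)` mapping
`ℤⁿ` to the rescaled kernel of the form, and `SL(n, ℤ)` permutes the corresponding lattices. -/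
theorem exists_hecke (n P : ℕ) [Fact P.Prime] :
    ∃ (M : {a : Fin n → ZMod P // a ≠ 0} → Matrix (Fin n) (Fin n) ℤ)
      (δ : {a : Fin n → ZMod P // a ≠ 0} → SLR n),
      (∀ a, (δ a : Matrix (Fin n) (Fin n) ℝ) =
        (P : ℝ) ^ (-(1 / n : ℝ)) • (M a).map (fun z : ℤ => (z : ℝ))) ∧
      (∀ a, (M a).det ≠ 0) ∧
      (∀ a u, (∃ v, M a *ᵥ v = u) ↔ ∑ i, a.1 i * (u i : ZMod P) = 0) ∧
      ∀ γ ∈ SLZ n, ∃ e : {a : Fin n → ZMod P // a ≠ 0} ≃ {a : Fin n → ZMod P // a ≠ 0},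
        ∀ a, ((γ * δ a : SLR n) : SLR n ⧸ SLZ n) = δ (e a) := by
  have hP : (0 : ℝ) < P := by exact_mod_cast (Fact.out : P.Prime).pos
  choose M hdet hM using fun a : {a : Fin n → ZMod P // a ≠ 0} =>
    exists_matrix_range_eq_ker a.1 a.2
  have hmap (A : Matrix (Fin n) (Fin n) ℤ) : (A.map fun z : ℤ => (z : ℝ)).det = A.det :=
    ((Int.castRingHom ℝ).map_det A).symm
  have hn (a : {a : Fin n → ZMod P // a ≠ 0}) : (n : ℝ) ≠ 0 := by
    obtain ⟨i, hi⟩ := Function.ne_iff.1 a.2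
    exact_mod_cast (Fin.pos i).ne'
  have hδ (a : {a : Fin n → ZMod P // a ≠ 0}) :
      ((P : ℝ) ^ (-(1 / n : ℝ)) • (M a).map (fun z : ℤ => (z : ℝ))).det = 1 := by
    rw [det_smul, hmap, hdet, Fintype.card_fin, ← Real.rpow_natCast, ← Real.rpow_mul hP.le,
      neg_mul, one_div_mul_cancel (hn a), Real.rpow_neg_one]
    push_cast
    exact inv_mul_cancel₀ hP.ne'
  obtain ⟨δ, hδM⟩ : ∃ δ : {a : Fin n → ZMod P // a ≠ 0} → SLR n,
      ∀ a, (δ a : Matrix (Fin n) (Fin n) ℝ) =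
        (P : ℝ) ^ (-(1 / n : ℝ)) • (M a).map (fun z : ℤ => (z : ℝ)) :=
    ⟨fun a => ⟨_, hδ a⟩, fun _ => rfl⟩
  refine ⟨M, δ, hδM, fun a => ?_, hM, ?_⟩
  · rw [hdet]; exact_mod_cast (Fact.out : P.Prime).ne_zero
  rintro _ ⟨γ, rfl⟩
  obtain ⟨A, hA⟩ : ∃ A, A = γ.1.map (Int.castRingHom (ZMod P)) := ⟨_, rfl⟩
  obtain ⟨B, hB⟩ : ∃ B, B = γ.1.adjugate.map (Int.castRingHom (ZMod P)) := ⟨_, rfl⟩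
  have hAB : A * B = 1 := by
    rw [hA, hB, ← Matrix.map_mul, mul_adjugate, γ.2]; simp
  have hBA : B * A = 1 := mul_eq_one_comm.1 hAB
  let e₀ : (Fin n → ZMod P) ≃ (Fin n → ZMod P) :=
    { toFun a := a ᵥ* B
      invFun a := a ᵥ* A
      left_inv a := by simp only [vecMul_vecMul, hBA, vecMul_one]
      right_inv a := by simp only [vecMul_vecMul, hAB, vecMul_one] }
  have he₀ (a) : a ≠ 0 ↔ e₀ a ≠ 0 := by
    have : e₀ 0 = 0 := zero_vecMul B
    rw [not_iff_not, ← e₀.injective.eq_iff, this]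
  refine ⟨e₀.subtypeEquiv (q := fun a => a ≠ 0) he₀, fun a => ?_⟩
  set a' := e₀.subtypeEquiv (q := fun a => a ≠ 0) he₀ a
  have hcol (j : Fin n) : ∃ v, M a' *ᵥ v = (γ.1 * M a).col j := by
    rw [hM]
    have h1 := (hM a ((M a).col j)).1 ⟨Pi.single j 1, by simp⟩
    have h2 : (fun i => (((γ.1 * M a).col j i : ℤ) : ZMod P)) =
        A *ᵥ fun i => (((M a).col j i : ℤ) : ZMod P) := by
      ext i
      simp [mul_apply, mulVec, dotProduct, hA]
    calc _ = a'.1 ⬝ᵥ (fun i => (((γ.1 * M a).col j i : ℤ) : ZMod P)) := rfl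
      _ = a.1 ⬝ᵥ fun i => (((M a).col j i : ℤ) : ZMod P) := by
        rw [h2]
        change (a.1 ᵥ* B) ⬝ᵥ _ = _
        rw [dotProduct_mulVec, vecMul_vecMul, hBA, vecMul_one]
      _ = 0 := h1
  choose v hv using hcol
  let V : Matrix (Fin n) (Fin n) ℤ := (Matrix.of v)ᵀ
  have hV : M a' * V = γ.1 * M a := by
    ext i j
    exact congrFun (hv j) i
  have hVdet : V.det = 1 := by
    have h := congrArg det hV
    rw [det_mul, det_mul, hdet, hdet, γ.2, one_mul] at h
    refine mul_left_cancel₀ ?_ (h.trans (mul_one _).symm)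
    exact_mod_cast (Fact.out : P.Prime).ne_zero
  symm
  rw [QuotientGroup.eq]
  refine ⟨⟨V, hVdet⟩, ?_⟩
  rw [eq_inv_mul_iff_mul_eq]
  have hVR : (M a').map (fun z : ℤ => (z : ℝ)) * V.map (fun z : ℤ => (z : ℝ)) =
      γ.1.map (fun z : ℤ => (z : ℝ)) * (M a).map (fun z : ℤ => (z : ℝ)) := by
    have := congrArg (fun A : Matrix (Fin n) (Fin n) ℤ => A.map (Int.castRingHom ℝ)) hV
    simp only [Matrix.map_mul] at this
    exact this
  refine Subtype.ext ?_
  change (δ a').1 * V.map (fun z : ℤ => (z : ℝ)) = γ.1.map (fun z : ℤ => (z : ℝ)) * (δ a).1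
  rw [hδM, hδM, smul_mul, Matrix.mul_smul, hVR]

open Matrix in
theorem det_mul_transpose_ne_zero {m n : ℕ} {u : Fin m → Fin n → ℤ} (hu : LinearIndependent ℤ u) :
    (Matrix.of u * (Matrix.of u)ᵀ).det ≠ 0 := by
  intro h
  obtain ⟨w, hw, h0⟩ := exists_vecMul_eq_zero_iff.2 h
  have h1 : (w ᵥ* Matrix.of u) ⬝ᵥ (w ᵥ* Matrix.of u) = 0 := by
    rw [← vecMul_vecMul] at h0
    have := congrArg (fun x => x ⬝ᵥ w) h0
    simp only [zero_dotProduct, vecMul_transpose] at this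
    rwa [dotProduct_comm, dotProduct_mulVec] at this
  rw [dotProduct_self_eq_zero] at h1
  refine hw (funext fun i => ?_)
  refine Fintype.linearIndependent_iff.1 hu w ?_ i
  rw [← h1]
  ext j
  simp [vecMul, dotProduct]

open Matrix in
/-- If the Gram determinant of `u` is nonzero modulo `P`, the orthogonal complement of `u`
modulo `P` has codimension `m`. -/
theorem card_ker_mul_pow {m n P : ℕ} [Fact P.Prime] {u : Fin m → Fin n → ℤ}
    (hu : ¬ (P : ℤ) ∣ (Matrix.of u * (Matrix.of u)ᵀ).det) :
    Fintype.card {a : Fin n → ZMod P // ∀ i, ∑ j, a j * (u i j : ZMod P) = 0} * P ^ m = P ^ n := by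
  let V : Matrix (Fin m) (Fin n) (ZMod P) := (Matrix.of u).map (Int.castRingHom (ZMod P))
  have hdet : IsUnit (V * Vᵀ).det := by
    have : V * Vᵀ = (Matrix.of u * (Matrix.of u)ᵀ).map (Int.castRingHom (ZMod P)) := by
      rw [Matrix.map_mul, ← transpose_map]
    rw [this, ← RingHom.mapMatrix_apply, ← RingHom.map_det, isUnit_iff_ne_zero]
    simpa [ZMod.intCast_zmod_eq_zero_iff_dvd] using hu
  let f := V.mulVecLin
  have hsurj : Function.Surjective f := fun y =>
    ⟨Vᵀ *ᵥ ((V * Vᵀ)⁻¹ *ᵥ y), by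
      simp only [f, mulVecLin_apply, mulVec_mulVec]
      rw [← Matrix.mul_assoc, mul_nonsing_inv _ hdet, one_mulVec]⟩
  have h1 := f.finrank_range_add_finrank_ker
  rw [LinearMap.range_eq_top.2 hsurj, finrank_top] at h1
  simp only [Module.finrank_fintype_fun_eq_card, Fintype.card_fin] at h1
  have h2 : Fintype.card {a : Fin n → ZMod P // ∀ i, ∑ j, a j * (u i j : ZMod P) = 0} =
      P ^ Module.finrank (ZMod P) (LinearMap.ker f) := by
    rw [← Nat.card_eq_fintype_card]
    have := Module.natCard_eq_pow_finrank (K := ZMod P) (V := LinearMap.ker f)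
    rw [Nat.card_zmod] at this
    rw [← this]
    refine Nat.card_congr (Equiv.subtypeEquivRight fun a => ?_)
    rw [LinearMap.mem_ker]
    simp [f, funext_iff, mulVec, dotProduct, V, mul_comm]
  rw [h2, ← pow_add, add_comm, h1]

theorem card_nonzero_ker_mul_pow_le {m n P : ℕ} [Fact P.Prime] {u : Fin m → Fin n → ℤ}
    (hu : ¬ (P : ℤ) ∣ (Matrix.of u * (Matrix.of u).transpose).det) :
    (Finset.univ.filter fun a : {a : Fin n → ZMod P // a ≠ 0} =>
        ∀ i, ∑ j, a.1 j * (u i j : ZMod P) = 0).card * P ^ m ≤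
      Fintype.card {a : Fin n → ZMod P // a ≠ 0} := by
  classical
  have h := card_ker_mul_pow hu
  have hP : 1 ≤ P ^ m := Nat.one_le_pow _ _ (Fact.out : P.Prime).pos
  have h1 : (Finset.univ.filter fun a : {a : Fin n → ZMod P // a ≠ 0} =>
        ∀ i, ∑ j, a.1 j * (u i j : ZMod P) = 0).card + 1 ≤
      Fintype.card {a : Fin n → ZMod P // ∀ i, ∑ j, a j * (u i j : ZMod P) = 0} := by
    rw [Fintype.card_subtype, ← Finset.card_map (Function.Embedding.subtype _)]
    rw [← Finset.card_cons (a := (0 : Fin n → ZMod P)) (by simp)]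
    refine Finset.card_le_card fun a => ?_
    simp only [Finset.mem_cons, Finset.mem_map, Finset.mem_filter, Finset.mem_univ, true_and]
    rintro (rfl | ⟨b, hb, rfl⟩)
    · simp
    · exact hb
  have h2 : Fintype.card {a : Fin n → ZMod P // a ≠ 0} + 1 = P ^ n := by
    have := Fintype.card_subtype_compl fun a : Fin n → ZMod P => a = 0
    simp only [Fintype.card_fun, ZMod.card, Fintype.card_fin, Fintype.card_unique] at this
    have h3 : 1 ≤ P ^ n := Nat.one_le_pow _ _ (Fact.out : P.Prime).pos
    change Fintype.card {a : Fin n → ZMod P // ¬ a = 0} + 1 = P ^ n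
    omega
  have h4 := Nat.mul_le_mul_right (P ^ m) h1
  rw [h, add_mul] at h4
  omega

/-- The real tuple underlying an integer tuple. -/
def tupleCast {m n : ℕ} (v : Fin m → Fin n → ℤ) : Fin m → Fin n → ℝ := fun i j => v i j

/-- The diagonal action of a matrix on tuples of vectors. -/
def tupleMap {m n : ℕ} (g : SLR n) (x : Fin m → Fin n → ℝ) : Fin m → Fin n → ℝ :=
  fun i => g.1.mulVec (x i)

theorem tupleMap_mul {m n : ℕ} (g h : SLR n) (x : Fin m → Fin n → ℝ) :
    tupleMap (g * h) x = tupleMap g (tupleMap h x) := by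
  ext1 i
  simp only [tupleMap, Matrix.SpecialLinearGroup.coe_mul, Matrix.mulVec_mulVec]

theorem continuous_tupleMap_left {m n : ℕ} (x : Fin m → Fin n → ℝ) :
    Continuous fun g : SLR n => tupleMap g x :=
  continuous_pi fun _ => (isClosedEmbedding_SLR_val n).continuous.matrix_mulVec continuous_const

theorem tupleMap_add {m n : ℕ} (g : SLR n) (x y : Fin m → Fin n → ℝ) :
    tupleMap g (x + y) = tupleMap g x + tupleMap g y :=
  funext fun _ => Matrix.mulVec_add _ _ _

theorem tupleMap_smul {m n : ℕ} (g : SLR n) (t : ℝ) (x : Fin m → Fin n → ℝ) :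
    tupleMap g (t • x) = t • tupleMap g x :=
  funext fun i => Matrix.mulVec_smul g.1 t (x i)

theorem tupleMap_sub {m n : ℕ} (g : SLR n) (x y : Fin m → Fin n → ℝ) :
    tupleMap g (x - y) = tupleMap g x - tupleMap g y :=
  funext fun _ => Matrix.mulVec_sub _ _ _

theorem exists_norm_tupleMap_le {n : ℕ} (m : ℕ) (g : SLR n) :
    ∃ K : ℝ, 0 < K ∧ ∀ x : Fin m → Fin n → ℝ, ‖tupleMap g x‖ ≤ K * ‖x‖ := by
  let f : (Fin m → Fin n → ℝ) →ₗ[ℝ] (Fin m → Fin n → ℝ) :=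
    { toFun := tupleMap g
      map_add' := tupleMap_add g
      map_smul' := tupleMap_smul g }
  exact (LinearMap.toContinuousLinearMap f).bound

theorem measurePreserving_tupleMap {m n : ℕ} (g : SLR n) :
    MeasurePreserving (tupleMap g : (Fin m → Fin n → ℝ) → Fin m → Fin n → ℝ) := by
  have h : MeasurePreserving (fun x : Fin n → ℝ => g.1.mulVec x) := by
    refine ⟨(Continuous.matrix_mulVec continuous_const continuous_id).measurable, ?_⟩
    have := Real.map_matrix_volume_pi_eq_smul_volume_pi (M := g.1) (by rw [g.2]; exact one_ne_zero)
    rw [g.2] at this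
    rw [inv_one, abs_one, ENNReal.ofReal_one, one_smul] at this
    exact this
  exact volume_preserving_pi fun _ => h

/-- Counting integer tuples satisfying a congruence modulo `q` by disjoint unit cubes. -/
theorem tsum_mul_pow_le_volume {m n q : ℕ} {p c : Fin m → ℤ}
    (hpc : (q : ℤ) ∣ ∑ i, p i * c i - 1) {U : Set (Fin m → Fin n → ℤ)}
    (hU : ∀ u ∈ U, ∀ j, (q : ℤ) ∣ ∑ i, p i * u i j) {E : Set (Fin m → Fin n → ℝ)} {B : ℝ}
    (hB0 : 0 ≤ B) (hB : ∀ i, |(c i : ℝ)| * q + 1 ≤ B)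
    (hE : ∀ u ∈ U, ∀ x, ‖x - tupleCast u‖ ≤ B → x ∈ E) :
    (∑' _ : U, (1 : ℝ≥0∞)) * (q : ℝ≥0∞) ^ n ≤ volume E := by
  let z : U × (Fin n → Fin q) → Fin m → Fin n → ℤ := fun ut i j => ut.1.1 i j + c i * (ut.2 j : ℕ)
  have hz : Function.Injective z := by
    rintro ⟨u, t⟩ ⟨u', t'⟩ h
    have ht : t = t' := by
      ext j
      have h1 (i) : (u.1 i j : ℤ) + c i * (t j : ℕ) = u'.1 i j + c i * (t' j : ℕ) :=
        congrFun₂ h i j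
      have h2 : (∑ i, p i * u.1 i j) + (∑ i, p i * c i) * (t j : ℕ) =
          (∑ i, p i * u'.1 i j) + (∑ i, p i * c i) * (t' j : ℕ) := by
        simp only [Finset.sum_mul, ← Finset.sum_add_distrib]
        exact Finset.sum_congr rfl fun i _ => by linear_combination p i * h1 i
      obtain ⟨a, ha⟩ := hU _ u.2 j
      obtain ⟨b, hb⟩ := hU _ u'.2 j
      obtain ⟨d, hd⟩ := hpc
      rw [ha, hb] at h2
      have h3 : ((t j : ℕ) : ℤ) ≡ ((t' j : ℕ) : ℤ) [ZMOD q] := by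
        rw [Int.modEq_iff_dvd]
        exact ⟨a - b + d * ((t j : ℕ) - (t' j : ℕ)), by
          linear_combination -h2 + (((t j : ℕ) : ℤ) - (t' j : ℕ)) * hd⟩
      exact Nat.ModEq.eq_of_lt_of_lt ((Int.natCast_modEq_iff).1 h3) (t j).2 (t' j).2
    subst ht
    have hu : u.1 = u'.1 := by
      ext i j
      exact add_right_cancel (congrFun₂ h i j)
    exact Prod.ext (Subtype.ext hu) rfl
  let cube : (Fin m → Fin n → ℤ) → Set (Fin m → Fin n → ℝ) := fun z =>
    Set.pi Set.univ fun i => Set.pi Set.univ fun j => Set.Ico (z i j : ℝ) (z i j + 1)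
  have hcm (z) : MeasurableSet (cube z) :=
    MeasurableSet.univ_pi fun i => MeasurableSet.univ_pi fun j => measurableSet_Ico
  have hcv (z) : volume (cube z) = 1 := by
    simp [cube, volume_pi_pi]
  have hfloor {z x} (hx : x ∈ cube z) (i j) : ⌊x i j⌋ = z i j := by
    rw [Int.floor_eq_iff]
    exact hx i trivial j trivial
  have hdisj : Pairwise (Function.onFun Disjoint fun ut => cube (z ut)) := fun a b hab =>
    Set.disjoint_left.2 fun x hx hx' => hab <| hz <| by
      ext i j
      rw [← hfloor hx, ← hfloor hx']
  have hsub : ⋃ ut, cube (z ut) ⊆ E := by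
    refine Set.iUnion_subset fun ⟨u, t⟩ x hx => hE u u.2 x ?_
    refine (pi_norm_le_iff_of_nonneg hB0).2 fun i => (pi_norm_le_iff_of_nonneg hB0).2 fun j => ?_
    refine le_trans ?_ (hB i)
    obtain ⟨h1, h2⟩ := hx i trivial j trivial
    simp only [z, Int.cast_add, Int.cast_mul, Int.cast_natCast] at h1 h2
    have h3 : |(c i : ℝ) * (t j : ℕ)| ≤ |(c i : ℝ)| * q := by
      rw [abs_mul, Nat.abs_cast]
      gcongr
      exact (t j).2.le
    rw [abs_le] at h3
    simp only [tupleCast, Pi.sub_apply, Real.norm_eq_abs, abs_le]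
    constructor <;> linarith
  calc (∑' _ : U, (1 : ℝ≥0∞)) * (q : ℝ≥0∞) ^ n = ∑' ut, volume (cube (z ut)) := by
        simp_rw [hcv]
        rw [ENNReal.tsum_prod (f := fun _ _ => (1 : ℝ≥0∞)), ← ENNReal.tsum_mul_right]
        simp
    _ = volume (⋃ ut, cube (z ut)) := (measure_iUnion hdisj fun _ => hcm _).symm
    _ ≤ volume E := measure_mono hsub

/-- The number of integer tuples in `A` that `g` maps into `W`. -/
def latticeCount {m n : ℕ} (A : Set (Fin m → Fin n → ℤ)) (W : Set (Fin m → Fin n → ℝ))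
    (g : SLR n) : ℝ≥0∞ :=
  ∑' v, {v | v ∈ A ∧ tupleMap g (tupleCast v) ∈ W}.indicator 1 v

/-- Independent integer tuples `v` with `∑ pᵢ vᵢ` divisible by `q`. -/
def admissibleTuples {m : ℕ} (n : ℕ) (p : Fin m → ℤ) (q : ℕ) : Set (Fin m → Fin n → ℤ) :=
  {v | LinearIndependent ℤ v ∧ ∀ j, (q : ℤ) ∣ ∑ i, p i * v i j}

open Matrix in
theorem not_dvd_det_gram {m n P : ℕ} {u : Fin m → Fin n → ℤ} (hu : LinearIndependent ℤ u) {b : ℝ}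
    (hb : ∀ i j, |(u i j : ℝ)| ≤ b) (hP : (m.factorial : ℝ) * (n * b ^ 2) ^ m < P) :
    ¬ (P : ℤ) ∣ (Matrix.of u * (Matrix.of u)ᵀ).det := by
  intro h
  refine det_mul_transpose_ne_zero hu (Int.eq_zero_of_abs_lt_dvd h ?_)
  have h1 := Matrix.det_le (A := (Matrix.of u * (Matrix.of u)ᵀ).map (Int.castRingHom ℝ))
    (abv := AbsoluteValue.abs) (x := n * b ^ 2) fun i j => by
      simp only [AbsoluteValue.abs_apply, map_apply, mul_apply, of_apply, transpose_apply,
        map_sum, map_mul, eq_intCast]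
      refine (Finset.abs_sum_le_sum_abs _ _).trans ?_
      refine (Finset.sum_le_card_nsmul _ _ (b ^ 2) fun k _ => ?_).trans (by simp)
      rw [abs_mul, sq]
      have := (abs_nonneg _).trans (hb i k)
      exact mul_le_mul (hb i k) (hb j k) (abs_nonneg _) this
  rw [← RingHom.mapMatrix_apply, ← RingHom.map_det] at h1
  simp only [AbsoluteValue.abs_apply, eq_intCast, Fintype.card_fin, nsmul_eq_mul] at h1
  exact_mod_cast h1.trans_lt hP

theorem tupleMap_hecke {m n P : ℕ} {M : Matrix (Fin n) (Fin n) ℤ} {δ : SLR n}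
    (h : (δ : Matrix (Fin n) (Fin n) ℝ) = (P : ℝ) ^ (-(1 / n : ℝ)) • M.map (fun z : ℤ => (z : ℝ)))
    (g : SLR n) (v : Fin m → Fin n → ℤ) :
    tupleMap (g * δ) (tupleCast v) =
      (P : ℝ) ^ (-(1 / n : ℝ)) • tupleMap g (tupleCast fun i => M.mulVec (v i)) := by
  rw [tupleMap_mul, ← tupleMap_smul]
  congr 1
  ext i j
  simp only [tupleMap, h, Matrix.smul_mulVec, Pi.smul_apply, tupleCast]
  congr 1
  simp [Matrix.mulVec, dotProduct, tupleCast]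

theorem mulVec_mem_admissibleTuples {m n q : ℕ} {p : Fin m → ℤ} {M : Matrix (Fin n) (Fin n) ℤ}
    (hM : M.det ≠ 0) {v : Fin m → Fin n → ℤ} (hv : v ∈ admissibleTuples n p q) :
    (fun i => M.mulVec (v i)) ∈ admissibleTuples n p q := by
  constructor
  · exact hv.1.map' M.mulVecLin (LinearMap.ker_eq_bot.2 (Matrix.mulVec_injective_of_det_ne_zero hM))
  · intro j
    have : ∑ i, p i * M.mulVec (v i) j = ∑ k, M j k * ∑ i, p i * v i k := by
      simp only [Matrix.mulVec, dotProduct, Finset.mul_sum]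
      rw [Finset.sum_comm]
      exact Finset.sum_congr rfl fun _ _ => Finset.sum_congr rfl fun _ _ => by ring
    rw [this]
    exact Finset.dvd_sum fun k _ => (hv.2 k).mul_left _

theorem volume_preimage_smul_tupleMap {m n P : ℕ} (hn : n ≠ 0) (hP : 0 < P) (g : SLR n)
    {W : Set (Fin m → Fin n → ℝ)} (hW : MeasurableSet W) :
    volume {x | (P : ℝ) ^ (-(1 / n : ℝ)) • tupleMap g x ∈ W} = (P : ℝ≥0∞) ^ m * volume W := by
  have hP' : (0 : ℝ) < P := by exact_mod_cast hP
  have ht : (P : ℝ) ^ (-(1 / n : ℝ)) ≠ 0 := (Real.rpow_pos_of_pos hP' _).ne'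
  have h1 : {x | (P : ℝ) ^ (-(1 / n : ℝ)) • tupleMap g x ∈ W} =
    tupleMap g ⁻¹' ((fun x => (P : ℝ) ^ (-(1 / n : ℝ)) • x) ⁻¹' W) := rfl
  rw [h1, (measurePreserving_tupleMap g).measure_preimage
    (hW.preimage (measurable_const_smul _)).nullMeasurableSet, Measure.addHaar_preimage_smul _ ht]
  congr 1
  have h2 : Module.finrank ℝ (Fin m → Fin n → ℝ) = n * m := by
    simp [Module.finrank_pi_fintype, mul_comm]
  have h3 : ((P : ℝ) ^ (-(1 / n : ℝ))) ^ n = (P : ℝ)⁻¹ := by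
    rw [← Real.rpow_natCast, ← Real.rpow_mul hP'.le, neg_mul, one_div_mul_cancel (by simpa using hn),
      Real.rpow_neg_one]
  rw [h2, pow_mul, h3, inv_pow, inv_inv, abs_of_pos (by positivity), ENNReal.ofReal_pow hP'.le,
    ENNReal.ofReal_natCast]

theorem tendsto_rpow_neg_one_div {n : ℕ} (hn : n ≠ 0) :
    Filter.Tendsto (fun P : ℕ => (P : ℝ) ^ (-(1 / n : ℝ))) Filter.atTop (𝓝 0) :=
  (tendsto_rpow_neg_atTop (by positivity)).comp tendsto_natCast_atTop_atTop

theorem eventually_mul_rpow_lt {m n : ℕ} (hmn : 2 * m < n) (C : ℝ) (b : ℝ) :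
    ∀ᶠ P : ℕ in Filter.atTop,
      C * (n * (b / (P : ℝ) ^ (-(1 / n : ℝ))) ^ 2) ^ m < P := by
  have hn : (0 : ℝ) < n := by exact_mod_cast (by omega : 0 < n)
  have he : 0 < 1 - 2 * m / (n : ℝ) := by
    rw [sub_pos, div_lt_one hn]
    exact_mod_cast hmn
  have h := ((tendsto_rpow_atTop he).comp tendsto_natCast_atTop_atTop).eventually_gt_atTop
    (C * (n * b ^ 2) ^ m)
  filter_upwards [h, Filter.eventually_gt_atTop 0] with P hP h0
  have hP0 : (0 : ℝ) < P := by exact_mod_cast h0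
  have h1 : ((n : ℝ) * (b / (P : ℝ) ^ (-(1 / n : ℝ))) ^ 2) ^ m =
      (n * b ^ 2) ^ m * (P : ℝ) ^ (2 * m / (n : ℝ)) := by
    rw [Real.rpow_neg hP0.le, div_inv_eq_mul, mul_pow b, ← mul_assoc, mul_pow, ← pow_mul,
      ← Real.rpow_natCast ((P : ℝ) ^ (1 / n : ℝ)), ← Real.rpow_mul hP0.le]
    push_cast
    congr 2
    ring
  rw [h1, ← mul_assoc]
  calc _ < (P : ℝ) ^ (1 - 2 * m / (n : ℝ)) * (P : ℝ) ^ (2 * m / (n : ℝ)) := by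
        gcongr
        exact hP
    _ = P := by rw [← Real.rpow_add hP0]; simp

theorem sum_latticeCount_hecke_le {m n q P : ℕ} [Fact P.Prime] {p : Fin m → ℤ}
    {M : {a : Fin n → ZMod P // a ≠ 0} → Matrix (Fin n) (Fin n) ℤ}
    {δ : {a : Fin n → ZMod P // a ≠ 0} → SLR n}
    (hδ : ∀ a, (δ a : Matrix (Fin n) (Fin n) ℝ) =
        (P : ℝ) ^ (-(1 / n : ℝ)) • (M a).map (fun z : ℤ => (z : ℝ)))
    (hdet : ∀ a, (M a).det ≠ 0)
    (hM : ∀ a u, (∃ v, (M a).mulVec v = u) ↔ ∑ i, a.1 i * (u i : ZMod P) = 0)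
    (W : Set (Fin m → Fin n → ℝ)) (g : SLR n) {b : ℝ}
    (hb : ∀ u, (P : ℝ) ^ (-(1 / n : ℝ)) • tupleMap g (tupleCast u) ∈ W → ∀ i j, |(u i j : ℝ)| ≤ b)
    (hP : (m.factorial : ℝ) * (n * b ^ 2) ^ m < P) :
    (Fintype.card {a : Fin n → ZMod P // a ≠ 0} : ℝ≥0∞)⁻¹ *
        ∑ a, latticeCount (admissibleTuples n p q) W (g * δ a) ≤
      (∑' _ : {u | u ∈ admissibleTuples n p q ∧
        (P : ℝ) ^ (-(1 / n : ℝ)) • tupleMap g (tupleCast u) ∈ W}, (1 : ℝ≥0∞)) / (P : ℝ≥0∞) ^ m := by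
  set N := Fintype.card {a : Fin n → ZMod P // a ≠ 0}
  set U := {u | u ∈ admissibleTuples n p q ∧
        (P : ℝ) ^ (-(1 / n : ℝ)) • tupleMap g (tupleCast u) ∈ W}
  have hP0 : (P : ℝ≥0∞) ^ m ≠ 0 :=
    pow_ne_zero _ (by exact_mod_cast (Fact.out : P.Prime).ne_zero)
  have hPt : (P : ℝ≥0∞) ^ m ≠ ∞ := ENNReal.pow_ne_top (ENNReal.natCast_ne_top _)
  let f (a : {a : Fin n → ZMod P // a ≠ 0}) (u : Fin m → Fin n → ℤ) : ℝ≥0∞ :=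
    U.indicator 1 u * if ∀ i, ∑ j, a.1 j * (u i j : ZMod P) = 0 then 1 else 0
  have h1 (a) : latticeCount (admissibleTuples n p q) W (g * δ a) ≤ ∑' u, f a u := by
    have hinj : Function.Injective fun v : Fin m → Fin n → ℤ => fun i => (M a).mulVec (v i) :=
      fun v v' h => funext fun i => Matrix.mulVec_injective_of_det_ne_zero (hdet a) (congrFun h i)
    refine le_trans (ENNReal.tsum_le_tsum fun v => ?_)
      (ENNReal.tsum_comp_le_tsum_of_injective hinj (f a))
    by_cases hvU : v ∈ {v | v ∈ admissibleTuples n p q ∧ tupleMap (g * δ a) (tupleCast v) ∈ W}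
    swap
    · rw [Set.indicator_of_notMem hvU]; exact zero_le
    rw [Set.indicator_of_mem hvU]
    obtain ⟨hv, hvW⟩ := hvU
    rw [tupleMap_hecke (hδ a)] at hvW
    have h2 : (fun i => (M a).mulVec (v i)) ∈ U := ⟨mulVec_mem_admissibleTuples (hdet a) hv, hvW⟩
    simp only [f]
    rw [Set.indicator_of_mem h2, if_pos fun i => (hM a _).1 ⟨_, rfl⟩]
    simp
  have h2 (u) : ∑ a, f a u ≤ U.indicator 1 u * (N / (P : ℝ≥0∞) ^ m) := by
    simp only [f]
    rw [← Finset.mul_sum, Finset.sum_boole]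
    by_cases hu : u ∈ U
    · gcongr
      rw [ENNReal.le_div_iff_mul_le (.inl hP0) (.inl hPt)]
      exact_mod_cast card_nonzero_ker_mul_pow_le (not_dvd_det_gram hu.1.1 (hb u hu.2) hP)
    · simp [hu]
  have h3 : (N : ℝ≥0∞)⁻¹ * N ≤ 1 := ENNReal.inv_mul_le_one _
  calc _ ≤ (N : ℝ≥0∞)⁻¹ * ∑ a, ∑' u, f a u := by gcongr with a; exact h1 a
    _ = (N : ℝ≥0∞)⁻¹ * ∑' u, ∑ a, f a u := by
      rw [Summable.tsum_finsetSum fun _ _ => ENNReal.summable]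
    _ ≤ (N : ℝ≥0∞)⁻¹ * ∑' u, U.indicator 1 u * (N / (P : ℝ≥0∞) ^ m) := by
      gcongr with u; exact h2 u
    _ = ((N : ℝ≥0∞)⁻¹ * N) * ((∑' _ : U, (1 : ℝ≥0∞)) / (P : ℝ≥0∞) ^ m) := by
      rw [ENNReal.tsum_mul_right, tsum_subtype U fun _ => (1 : ℝ≥0∞)]
      simp only [ENNReal.div_eq_inv_mul]
      change _ * ((∑' x, U.indicator 1 x) * _) = _ * (_ * ∑' x, U.indicator 1 x)
      ring
    _ ≤ 1 * _ := by gcongr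
    _ = _ := one_mul _

theorem eventually_sum_latticeCount_le {m n q : ℕ} (hmn : 2 * m < n) (hq : q ≠ 0) {p c : Fin m → ℤ}
    (hpc : (q : ℤ) ∣ ∑ i, p i * c i - 1) {W' W : Set (Fin m → Fin n → ℝ)} {R ε : ℝ} (hε : 0 < ε)
    (hW' : ∀ x ∈ W', ‖x‖ ≤ R) (hW : MeasurableSet W) (h : ∀ x ∈ W', ∀ y, ‖y - x‖ ≤ ε → y ∈ W)
    (g : SLR n) :
    ∀ᶠ P : ℕ in Filter.atTop, ∀ [Fact P.Prime]
      {M : {a : Fin n → ZMod P // a ≠ 0} → Matrix (Fin n) (Fin n) ℤ}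
      {δ : {a : Fin n → ZMod P // a ≠ 0} → SLR n},
      (∀ a, (δ a : Matrix (Fin n) (Fin n) ℝ) =
        (P : ℝ) ^ (-(1 / n : ℝ)) • (M a).map (fun z : ℤ => (z : ℝ))) →
      (∀ a, (M a).det ≠ 0) →
      (∀ a u, (∃ v, (M a).mulVec v = u) ↔ ∑ i, a.1 i * (u i : ZMod P) = 0) →
      (Fintype.card {a : Fin n → ZMod P // a ≠ 0} : ℝ≥0∞)⁻¹ *
        ∑ a, latticeCount (admissibleTuples n p q) W' (g * δ a) ≤ volume W / (q : ℝ≥0∞) ^ n := by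
  have hn : n ≠ 0 := by omega
  obtain ⟨K, hK, hKg⟩ := exists_norm_tupleMap_le m g
  obtain ⟨K', hK', hKg'⟩ := exists_norm_tupleMap_le m g⁻¹
  obtain ⟨B, hB⟩ : ∃ B, ∀ i, |(c i : ℝ)| * q + 1 ≤ B :=
    ⟨∑ i, (|(c i : ℝ)| * q + 1), fun i =>
      Finset.single_le_sum (f := fun i => |(c i : ℝ)| * q + 1) (fun i _ => by positivity)
        (Finset.mem_univ i)⟩
  have h1 : ∀ᶠ P : ℕ in Filter.atTop, (P : ℝ) ^ (-(1 / n : ℝ)) < ε / (K * (|B| + 1)) :=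
    (tendsto_rpow_neg_one_div hn).eventually_lt_const (by positivity)
  filter_upwards [h1, eventually_mul_rpow_lt hmn (m.factorial) (K' * R)] with P hP1 hP2 _ M δ hδ hdet hM
  have hP0 : (0 : ℝ) < P := by exact_mod_cast (Fact.out : P.Prime).pos
  have ht : 0 < (P : ℝ) ^ (-(1 / n : ℝ)) := Real.rpow_pos_of_pos hP0 _
  refine (sum_latticeCount_hecke_le hδ hdet hM W' g (b := K' * R / (P : ℝ) ^ (-(1 / n : ℝ)))
    (fun u hu i j => ?_) hP2).trans ?_
  · have h2 := hW' _ hu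
    have h3 := hKg' (tupleMap g (tupleCast u))
    rw [← tupleMap_mul, inv_mul_cancel] at h3
    have h4 : tupleMap (1 : SLR n) (tupleCast u) = tupleCast u := by
      ext1 i; simp [tupleMap]
    rw [h4] at h3
    rw [norm_smul, Real.norm_of_nonneg ht.le] at h2
    rw [le_div_iff₀ ht]
    have h5 : |(u i j : ℝ)| ≤ ‖tupleCast u‖ :=
      (norm_le_pi_norm (tupleCast u i) j).trans (norm_le_pi_norm (tupleCast u) i)
    calc |(u i j : ℝ)| * (P : ℝ) ^ (-(1 / n : ℝ))
        ≤ (K' * ‖tupleMap g (tupleCast u)‖) * (P : ℝ) ^ (-(1 / n : ℝ)) := by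
          gcongr; exact h5.trans h3
      _ ≤ K' * R := by nlinarith
  · have h2 := tsum_mul_pow_le_volume (n := n) hpc (U := {u | u ∈ admissibleTuples n p q ∧
        (P : ℝ) ^ (-(1 / n : ℝ)) • tupleMap g (tupleCast u) ∈ W'}) (fun u hu => hu.1.2)
        (E := {x | (P : ℝ) ^ (-(1 / n : ℝ)) • tupleMap g x ∈ W}) (B := |B|) (abs_nonneg _)
        (fun i => (hB i).trans (le_abs_self _)) (fun u hu x hx => h _ hu.2 _ ?_)
    · rw [volume_preimage_smul_tupleMap hn (Fact.out : P.Prime).pos g hW] at h2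
      have hP0 : (P : ℝ≥0∞) ^ m ≠ 0 :=
        pow_ne_zero _ (by exact_mod_cast (Fact.out : P.Prime).ne_zero)
      have hPt : (P : ℝ≥0∞) ^ m ≠ ∞ := ENNReal.pow_ne_top (ENNReal.natCast_ne_top _)
      have hq0 : (q : ℝ≥0∞) ^ n ≠ 0 := pow_ne_zero _ (by exact_mod_cast hq)
      have hqt : (q : ℝ≥0∞) ^ n ≠ ∞ := ENNReal.pow_ne_top (ENNReal.natCast_ne_top _)
      rw [ENNReal.div_le_iff hP0 hPt, ← ENNReal.mul_div_right_comm,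
        ENNReal.le_div_iff_mul_le (.inl hq0) (.inl hqt), mul_comm (volume W)]
      exact h2
    · rw [← smul_sub, ← tupleMap_sub, norm_smul, Real.norm_of_nonneg ht.le]
      have h6 := hKg (x - tupleCast u)
      rw [lt_div_iff₀ (by positivity)] at hP1
      calc _ ≤ (P : ℝ) ^ (-(1 / n : ℝ)) * (K * (|B| + 1)) := by
            gcongr
            refine h6.trans ?_
            gcongr
            linarith
        _ ≤ ε := hP1.le

theorem measurable_latticeCount {m n : ℕ} (A : Set (Fin m → Fin n → ℤ))
    {W : Set (Fin m → Fin n → ℝ)} (hW : MeasurableSet W) :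
    Measurable (latticeCount A W : SLR n → ℝ≥0∞) := by
  refine Measurable.tsum fun v => ?_
  have h : MeasurableSet {g : SLR n | v ∈ A ∧ tupleMap g (tupleCast v) ∈ W} :=
    (MeasurableSet.const _).inter (hW.preimage (continuous_tupleMap_left _).measurable)
  exact measurable_one.indicator h

theorem indicator_latticeCount_mono {m n : ℕ} (A : Set (Fin m → Fin n → ℤ))
    {W W' : Set (Fin m → Fin n → ℝ)} (h : W ⊆ W') (g : SLR n) (v : Fin m → Fin n → ℤ) :
    {v | v ∈ A ∧ tupleMap g (tupleCast v) ∈ W}.indicator (1 : (Fin m → Fin n → ℤ) → ℝ≥0∞) v ≤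
      {v | v ∈ A ∧ tupleMap g (tupleCast v) ∈ W'}.indicator 1 v :=
  Set.indicator_le_indicator_of_subset (s := {v | v ∈ A ∧ tupleMap g (tupleCast v) ∈ W})
    (t := {v | v ∈ A ∧ tupleMap g (tupleCast v) ∈ W'}) (fun _ hv => ⟨hv.1, h hv.2⟩)
    (fun _ => zero_le) v

theorem latticeCount_mono {m n : ℕ} (A : Set (Fin m → Fin n → ℤ))
    {W W' : Set (Fin m → Fin n → ℝ)} (h : W ⊆ W') (g : SLR n) :
    latticeCount A W g ≤ latticeCount A W' g :=
  ENNReal.tsum_le_tsum fun v => indicator_latticeCount_mono A h g v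

theorem latticeCount_mul_le {m n q : ℕ} {p : Fin m → ℤ} (W : Set (Fin m → Fin n → ℝ))
    (g γ : SLR n) (hγ : γ ∈ SLZ n) :
    latticeCount (admissibleTuples n p q) W (g * γ) ≤ latticeCount (admissibleTuples n p q) W g := by
  obtain ⟨γ, rfl⟩ := hγ
  have hdet : γ.1.det ≠ 0 := by rw [γ.2]; exact one_ne_zero
  have hinj : Function.Injective fun v : Fin m → Fin n → ℤ => fun i => γ.1.mulVec (v i) :=
    fun v v' h => funext fun i => Matrix.mulVec_injective_of_det_ne_zero hdet (congrFun h i)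
  refine le_trans (ENNReal.tsum_le_tsum fun v => ?_) (ENNReal.tsum_comp_le_tsum_of_injective hinj
    ({v | v ∈ admissibleTuples n p q ∧ tupleMap g (tupleCast v) ∈ W}.indicator 1))
  by_cases hv : v ∈ admissibleTuples n p q ∧
      tupleMap (g * Matrix.SpecialLinearGroup.map (Int.castRingHom ℝ) γ) (tupleCast v) ∈ W
  · have hc : tupleMap (Matrix.SpecialLinearGroup.map (Int.castRingHom ℝ) γ) (tupleCast v) =
        tupleCast fun i => γ.1.mulVec (v i) := by
      ext i j
      simp [tupleMap, tupleCast, Matrix.mulVec, dotProduct]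
    rw [Set.indicator_of_mem (by exact hv), Set.indicator_of_mem]
    · rfl
    · refine ⟨mulVec_mem_admissibleTuples hdet hv.1, ?_⟩
      rw [← hc, ← tupleMap_mul]
      exact hv.2
  · rw [Set.indicator_of_notMem (by exact hv)]
    exact zero_le

theorem latticeCount_mul {m n q : ℕ} {p : Fin m → ℤ} (W : Set (Fin m → Fin n → ℝ))
    (g γ : SLR n) (hγ : γ ∈ SLZ n) :
    latticeCount (admissibleTuples n p q) W (g * γ) = latticeCount (admissibleTuples n p q) W g := by
  refine (latticeCount_mul_le W g γ hγ).antisymm ?_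
  have := latticeCount_mul_le (p := p) (q := q) W (g * γ) γ⁻¹ (inv_mem hγ)
  rwa [mul_inv_cancel_right] at this

theorem lintegral_min_latticeCount_le {m n q : ℕ} (hmn : 2 * m < n) (hq : q ≠ 0) {p c : Fin m → ℤ}
    (hpc : (q : ℤ) ∣ ∑ i, p i * c i - 1) {W' W : Set (Fin m → Fin n → ℝ)} {R ε : ℝ} (hε : 0 < ε)
    (hW' : ∀ x ∈ W', ‖x‖ ≤ R) (hm : MeasurableSet W') (hW : MeasurableSet W)
    (h : ∀ x ∈ W', ∀ y, ‖y - x‖ ≤ ε → y ∈ W)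
    (μ : Measure (LatticeSpace n)) [IsProbabilityMeasure μ]
    (hμ : ∀ g : SLR n, Measure.map (fun x => g • x) μ = μ) (N : ℕ) :
    ∫⁻ x, min (latticeCount (admissibleTuples n p q) W' (Quotient.out (α := SLR n) x)) N ∂μ ≤
      volume W / (q : ℝ≥0∞) ^ n := by
  choose P hPj hP using Nat.exists_infinite_primes
  have hPf (j) : Fact (P j).Prime := ⟨hP j⟩
  choose M δ hδ hdet hM hΓ using fun j => exists_hecke n (P j)
  let f : SLR n → ℝ≥0∞ := fun g => min (latticeCount (admissibleTuples n p q) W' g) N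
  have hf : Measurable f := (measurable_latticeCount _ hm).min measurable_const
  have hinv (g : SLR n) (γ) (hγ : γ ∈ SLZ n) : f (g * γ) = f g := by
    simp only [f, latticeCount_mul W' g γ hγ]
  have hne (j) : Nonempty {a : Fin n → ZMod (P j) // a ≠ 0} :=
    ⟨⟨fun _ => 1, fun h => one_ne_zero (congrFun h ⟨0, by omega⟩)⟩⟩
  let F (j : ℕ) (g : SLR n) : ℝ≥0∞ :=
    (Fintype.card {a : Fin n → ZMod (P j) // a ≠ 0} : ℝ≥0∞)⁻¹ * ∑ a, f (g * δ j a)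
  have hFm (j) : Measurable fun x : LatticeSpace n => F j (Quotient.out (α := SLR n) x) := by
    refine measurable_latticeSpace_out ?_ fun g γ hγ => ?_
    · exact (Finset.measurable_sum _ fun a _ => hf.comp (measurable_mul_const _)).const_mul _
    · have := sum_apply_mul_mul (hΓ j) (fun x => f (Quotient.out (α := SLR n) x)) g γ hγ
      have hout (g : SLR n) : f (Quotient.out (g : SLR n ⧸ SLZ n)) = f g :=
        QuotientGroup.apply_out_mk hinv g
      simp only [hout] at this
      simp only [F, this]
  have h1 (j) : ∫⁻ x, f (Quotient.out (α := SLR n) x) ∂μ =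
      ∫⁻ x, F j (Quotient.out (α := SLR n) x) ∂μ :=
    lintegral_eq_lintegral_average (hΓ j) μ hμ hf hinv
  have hFN (j g) : F j g ≤ N := by
    calc F j g ≤ (Fintype.card {a : Fin n → ZMod (P j) // a ≠ 0} : ℝ≥0∞)⁻¹ *
          ∑ _a : {a : Fin n → ZMod (P j) // a ≠ 0}, (N : ℝ≥0∞) := by
          simp only [F]
          gcongr
          exact min_le_right _ _
      _ = N := by
          rw [Finset.sum_const, Finset.card_univ, nsmul_eq_mul, ← mul_assoc,
            ENNReal.inv_mul_cancel (Nat.cast_ne_zero.2 Fintype.card_ne_zero) (ENNReal.natCast_ne_top _), one_mul]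
  have h2 : ∫⁻ x, f (Quotient.out (α := SLR n) x) ∂μ =
      Filter.limsup (fun j => ∫⁻ x, F j (Quotient.out (α := SLR n) x) ∂μ) Filter.atTop := by
    simp_rw [← h1]
    simp
  refine h2.trans_le <| (limsup_lintegral_le (fun _ => (N : ℝ≥0∞)) hFm
    (fun j => .of_forall fun x => hFN j _) (by simp)).trans ?_
  refine (lintegral_mono (g := fun _ => volume W / (q : ℝ≥0∞) ^ n) fun x => ?_).trans (by simp)
  refine Filter.limsup_le_of_le (by isBoundedDefault) ?_
  have hPt : Filter.Tendsto P Filter.atTop Filter.atTop :=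
    Filter.tendsto_atTop_mono hPj Filter.tendsto_id
  filter_upwards [hPt.eventually (eventually_sum_latticeCount_le hmn hq hpc hε hW' hW h
    (Quotient.out (α := SLR n) x))] with j hj
  refine le_trans ?_ (hj (hδ j) (hdet j) (hM j))
  simp only [F, f]
  gcongr
  exact min_le_left _ _

theorem iSup_latticeCount {m n : ℕ} (A : Set (Fin m → Fin n → ℤ))
    {W : ℕ → Set (Fin m → Fin n → ℝ)} (hW : Monotone W) (g : SLR n) :
    ⨆ k, latticeCount A (W k) g = latticeCount A (⋃ k, W k) g := by
  have hmono (v) : Monotone fun k =>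
      {v | v ∈ A ∧ tupleMap g (tupleCast v) ∈ W k}.indicator (1 : (Fin m → Fin n → ℤ) → ℝ≥0∞) v :=
    fun k l hkl => indicator_latticeCount_mono A (hW hkl) g v
  simp only [latticeCount]
  simp_rw [← lintegral_count]
  rw [← lintegral_iSup (f := fun k v => {v | v ∈ A ∧ tupleMap g (tupleCast v) ∈ W k}.indicator
    (1 : (Fin m → Fin n → ℤ) → ℝ≥0∞) v) (fun k => measurable_of_countable _) fun k l hkl v => hmono v hkl]
  congr 1 with v
  refine le_antisymm (iSup_le fun k => ?_) ?_
  · exact indicator_latticeCount_mono A (Set.subset_iUnion W k) g v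
  · by_cases hv : v ∈ A ∧ tupleMap g (tupleCast v) ∈ ⋃ k, W k
    · obtain ⟨k, hk⟩ := Set.mem_iUnion.1 hv.2
      refine le_iSup_of_le k ?_
      rw [Set.indicator_of_mem (by exact hv), Set.indicator_of_mem (by exact ⟨hv.1, hk⟩)]
    · rw [Set.indicator_of_notMem (by exact hv)]
      exact zero_le

/-- **Rogers' inequality**: a bound for the mean number of independent lattice tuples satisfying
a congruence. -/
theorem lintegral_latticeCount_le {m n q : ℕ} (hmn : 2 * m < n) (hq : q ≠ 0) {p c : Fin m → ℤ}
    (hpc : (q : ℤ) ∣ ∑ i, p i * c i - 1) {W : Set (Fin m → Fin n → ℝ)} (hW : IsOpen W)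
    (μ : Measure (LatticeSpace n)) [IsProbabilityMeasure μ]
    (hμ : ∀ g : SLR n, Measure.map (fun x => g • x) μ = μ) :
    ∫⁻ x, latticeCount (admissibleTuples n p q) W (Quotient.out (α := SLR n) x) ∂μ ≤
      volume W / (q : ℝ≥0∞) ^ n := by
  let V : ℕ → Set (Fin m → Fin n → ℝ) := fun k =>
    Metric.closedBall 0 k ∩ (Metric.thickening (1 / (k + 1)) Wᶜ)ᶜ
  have hVm (k) : MeasurableSet (V k) :=
    (Metric.isClosed_closedBall.inter Metric.isOpen_thickening.isClosed_compl).measurableSet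
  have hV : Monotone V := fun k l hkl => by
    refine Set.inter_subset_inter (Metric.closedBall_subset_closedBall (by exact_mod_cast hkl)) ?_
    exact Set.compl_subset_compl.2 (Metric.thickening_mono (Nat.one_div_le_one_div hkl) _)
  have hU : ⋃ k, V k = W := by
    ext x
    simp only [V, Set.mem_iUnion, Set.mem_inter_iff, mem_closedBall_zero_iff, Set.mem_compl_iff,
      Metric.mem_thickening_iff, not_exists, not_and, not_lt]
    constructor
    · rintro ⟨k, -, hk⟩
      by_contra hx
      have := hk x hx
      rw [dist_self] at this
      exact absurd this (not_le.2 Nat.one_div_pos_of_nat)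
    · intro hx
      obtain ⟨ε, hε, hb⟩ := Metric.isOpen_iff.1 hW x hx
      obtain ⟨k, hk⟩ := exists_nat_one_div_lt hε
      obtain ⟨l, hl⟩ := exists_nat_ge ‖x‖
      refine ⟨max k l, hl.trans (by exact_mod_cast le_max_right k l), fun y hy => ?_⟩
      refine (Nat.one_div_le_one_div (le_max_left k l)).trans (hk.le.trans ?_)
      by_contra! hlt
      exact hy (hb (by rwa [Metric.mem_ball, dist_comm]))
  have hmin (g : SLR n) : latticeCount (admissibleTuples n p q) W g =
      ⨆ k : ℕ, min (latticeCount (admissibleTuples n p q) (V k) g) k := by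
    rw [← hU, ← iSup_latticeCount _ hV]
    have h := iSup_inf_of_monotone (f := fun k => latticeCount (admissibleTuples n p q) (V k) g)
      (g := fun k : ℕ => (k : ℝ≥0∞)) ?_ Nat.mono_cast
    · rw [ENNReal.iSup_natCast, inf_top_eq] at h
      exact h.symm
    · exact fun k l hkl => latticeCount_mono _ (hV hkl) g
  simp_rw [hmin]
  rw [lintegral_iSup]
  · refine iSup_le fun k => ?_
    have hk : (0 : ℝ) < 1 / (k + 1) := Nat.one_div_pos_of_nat
    refine lintegral_min_latticeCount_le hmn hq hpc (R := k) (half_pos hk)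
      (fun x hx => mem_closedBall_zero_iff.1 hx.1) (hVm k) hW.measurableSet
      (fun x hx y hy => ?_) μ hμ k
    by_contra hyW
    refine hx.2 (Metric.mem_thickening_iff.2 ⟨y, hyW, ?_⟩)
    rw [dist_comm, dist_eq_norm]
    linarith
  · exact fun k => measurable_latticeSpace_out
      ((measurable_latticeCount _ (hVm k)).min measurable_const) fun g γ hγ => by
        rw [latticeCount_mul (V k) g γ hγ]
  · exact fun k l hkl x => min_le_min (latticeCount_mono _ (hV hkl) _)
      (by exact_mod_cast hkl)

theorem ENNReal.geom_le_weighted_sum {a b c : ℝ} (ha : 0 < a) (hb : 0 < b) (hc : 0 < c)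
    (h : 64 * a ^ 2 * b * c = 1) (X Y Z : ℝ≥0∞) :
    X ^ (1 / 2 : ℝ) * Y ^ (1 / 4 : ℝ) * Z ^ (1 / 4 : ℝ) ≤
      ENNReal.ofReal a * X + ENNReal.ofReal b * Y + ENNReal.ofReal c * Z := by
  have ha' := (ENNReal.ofReal_pos.2 ha).ne'
  have hb' := (ENNReal.ofReal_pos.2 hb).ne'
  have hc' := (ENNReal.ofReal_pos.2 hc).ne'
  rcases eq_or_ne X ∞ with rfl | hX
  · simp [ENNReal.mul_top ha']
  rcases eq_or_ne Y ∞ with rfl | hY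
  · simp [ENNReal.mul_top hb']
  rcases eq_or_ne Z ∞ with rfl | hZ
  · simp [ENNReal.mul_top hc']
  lift X to NNReal using hX
  lift Y to NNReal using hY
  lift Z to NNReal using hZ
  lift a to NNReal using ha.le
  lift b to NNReal using hb.le
  lift c to NNReal using hc.le
  have key := NNReal.geom_mean_le_arith_mean3_weighted (1 / 2) (1 / 4) (1 / 4) (2 * a * X)
    (4 * b * Y) (4 * c * Z) (by rw [← NNReal.coe_inj]; push_cast; norm_num)
  simp only [NNReal.mul_rpow, NNReal.coe_div, NNReal.coe_one, NNReal.coe_ofNat] at key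
  have h1 : (2 * a) ^ (1 / 2 : ℝ) * (4 * b) ^ (1 / 4 : ℝ) * (4 * c) ^ (1 / 4 : ℝ) = (1 : NNReal) := by
    have : (2 * a) ^ (1 / 2 : ℝ) = ((2 * a) ^ 2) ^ (1 / 4 : ℝ) := by
      rw [← NNReal.rpow_natCast, ← NNReal.rpow_mul]; norm_num
    rw [this, ← NNReal.mul_rpow, ← NNReal.mul_rpow]
    have h2 : (2 * a) ^ 2 * (4 * b) * (4 * c) = 1 := by
      rw [← NNReal.coe_inj]; push_cast; linarith
    rw [h2, NNReal.one_rpow]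
  simp only [ENNReal.ofReal_coe_nnreal]
  rw [← ENNReal.coe_rpow_of_nonneg _ (by norm_num), ← ENNReal.coe_rpow_of_nonneg _ (by norm_num),
    ← ENNReal.coe_rpow_of_nonneg _ (by norm_num)]
  norm_cast
  simp only [NNReal.mul_rpow] at h1
  calc X ^ (1 / 2 : ℝ) * Y ^ (1 / 4 : ℝ) * Z ^ (1 / 4 : ℝ)
      = (2 ^ (1 / 2 : ℝ) * a ^ (1 / 2 : ℝ) * (4 ^ (1 / 4 : ℝ) * b ^ (1 / 4 : ℝ)) *
          (4 ^ (1 / 4 : ℝ) * c ^ (1 / 4 : ℝ))) *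
        (X ^ (1 / 2 : ℝ) * Y ^ (1 / 4 : ℝ) * Z ^ (1 / 4 : ℝ)) := by rw [h1, one_mul]
    _ = _ := by ring
    _ ≤ _ := key
    _ = a * X + b * Y + c * Z := by
      rw [← NNReal.coe_inj]; push_cast; ring

open ProbabilityTheory in
theorem exists_median {F : ℝ → ℝ≥0∞} (h1 : ∫⁻ x, F x = 1) :
    ∃ α, ∫⁻ x in Set.Iio α, F x = 1 / 2 ∧ ∫⁻ x in (Set.Iio α)ᶜ, F x = 1 / 2 := by
  let ν : Measure ℝ := volume.withDensity F
  have hν : IsProbabilityMeasure ν := ⟨by simp [ν, withDensity_apply, h1]⟩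
  have hac : ν ≪ volume := withDensity_absolutelyContinuous _ _
  have hc : Continuous (cdf ν) := by
    refine continuous_iff_continuousAt.2 fun x => ?_
    rw [(monotone_cdf ν).continuousAt_iff_leftLim_eq_rightLim, (cdf ν).rightLim_eq]
    have h2 := (cdf ν).measure_singleton x
    rw [measure_cdf, hac (by simp), eq_comm, ENNReal.ofReal_eq_zero] at h2
    exact le_antisymm ((monotone_cdf ν).leftLim_le le_rfl) (by linarith)
  obtain ⟨α, hα⟩ : (1 / 2 : ℝ) ∈ Set.range (cdf ν) := by
    refine mem_range_of_exists_le_of_exists_ge hc ?_ ?_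
    · exact ((tendsto_cdf_atBot ν).eventually_le_const (by norm_num)).exists
    · exact ((tendsto_cdf_atTop ν).eventually_const_le (by norm_num)).exists
  have h2 : ν (Set.Iio α) = 1 / 2 := by
    have : ν (Set.Iio α) = ν (Set.Iic α) := measure_congr (hac.ae_eq Iio_ae_eq_Iic)
    rw [this, ← ofReal_cdf, hα, ENNReal.ofReal_div_of_pos two_pos]
    simp
  refine ⟨α, ?_, ?_⟩
  · rwa [← withDensity_apply _ measurableSet_Iio]
  · rw [← withDensity_apply _ measurableSet_Iio.compl, prob_compl_eq_one_sub measurableSet_Iio, h2]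
    simp

theorem lintegral_ite_median {F : ℝ → ℝ≥0∞} (hF : Measurable F) {α : ℝ}
    (h1 : ∫⁻ x in Set.Iio α, F x = 1 / 2) (h2 : ∫⁻ x in (Set.Iio α)ᶜ, F x = 1 / 2)
    (p q : ℝ≥0∞) (P : Prop) [Decidable P] :
    ∫⁻ x, (if (x < α ↔ P) then p else q) * F x = (p + q) / 2 := by
  classical
  rw [← lintegral_add_compl _ (measurableSet_Iio (a := α))]
  have e1 : ∫⁻ x in Set.Iio α, (if (x < α ↔ P) then p else q) * F x =
      (if P then p else q) * (1 / 2) := by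
    rw [← h1, ← lintegral_const_mul _ hF]
    refine setLIntegral_congr_fun measurableSet_Iio fun x hx => ?_
    simp only [Set.mem_Iio] at hx
    simp [hx]
  have e2 : ∫⁻ x in (Set.Iio α)ᶜ, (if (x < α ↔ P) then p else q) * F x =
      (if P then q else p) * (1 / 2) := by
    rw [← h2, ← lintegral_const_mul _ hF]
    refine setLIntegral_congr_fun measurableSet_Iio.compl fun x hx => ?_
    simp only [Set.mem_compl_iff, Set.mem_Iio] at hx
    by_cases hP : P <;> simp [hx, hP]
  rw [e1, e2, ← add_mul, mul_one_div]
  split_ifs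
  · rfl
  · rw [add_comm]

theorem measurable_ite_iff_lt (α β : ℝ) (p q : ℝ≥0∞) :
    Measurable fun x : ℝ × ℝ => if (x.1 < α ↔ x.2 < β) then p else q := by
  refine Measurable.ite ?_ measurable_const measurable_const
  have h1 : MeasurableSet {x : ℝ × ℝ | x.1 < α} := measurableSet_Iio.preimage measurable_fst
  have h2 : MeasurableSet {x : ℝ × ℝ | x.2 < β} := measurableSet_Iio.preimage measurable_snd
  exact h1.iff h2

theorem lintegral_lintegral_ite_median {F G : ℝ → ℝ≥0∞} (hF : Measurable F) (hG : Measurable G)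
    {α : ℝ} (h1 : ∫⁻ x in Set.Iio α, F x = 1 / 2) (h2 : ∫⁻ x in (Set.Iio α)ᶜ, F x = 1 / 2)
    (hG1 : ∫⁻ x, G x = 1) (p q : ℝ≥0∞) (β : ℝ) :
    ∫⁻ x, ∫⁻ y, (if (x < α ↔ y < β) then p else q) * (F x * G y) = (p + q) / 2 := by
  rw [lintegral_lintegral_swap (((measurable_ite_iff_lt α β p q).mul
    ((hF.comp measurable_fst).mul (hG.comp measurable_snd))).aemeasurable)]
  simp_rw [← mul_assoc]
  have (y : ℝ) : ∫⁻ x, (if (x < α ↔ y < β) then p else q) * F x * G y = (p + q) / 2 * G y := by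
    rw [lintegral_mul_const, lintegral_ite_median hF h1 h2]
    exact ((measurable_ite_iff_lt α β p q).comp measurable_prodMk_right).mul hF
  simp_rw [this]
  rw [lintegral_const_mul _ hG, hG1, mul_one]

/-- A Young-type inequality with constant `K`. -/
def YoungBound (E : Type*) [Add E] [MeasureSpace E] (K : ℝ≥0∞) : Prop :=
  ∀ F G H : E → ℝ≥0∞, Measurable F → Measurable G → Measurable H →
    ∫⁻ x, ∫⁻ y, F x ^ (3 / 4 : ℝ) * G y ^ (3 / 4 : ℝ) * H (x + y) ^ (1 / 2 : ℝ) ≤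
      K * ((∫⁻ x, F x) ^ (3 / 4 : ℝ) * (∫⁻ x, G x) ^ (3 / 4 : ℝ) * (∫⁻ x, H x) ^ (1 / 2 : ℝ))

theorem lintegral_young_le_of_lintegral_eq_one {F G H : ℝ → ℝ≥0∞} (hF : Measurable F)
    (hG : Measurable G) (hH : Measurable H) (hF1 : ∫⁻ x, F x = 1) (hG1 : ∫⁻ x, G x = 1)
    (hH1 : ∫⁻ x, H x = 1) :
    ∫⁻ x, ∫⁻ y, F x ^ (3 / 4 : ℝ) * G y ^ (3 / 4 : ℝ) * H (x + y) ^ (1 / 2 : ℝ) ≤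
      ENNReal.ofReal (24 / 25) := by
  obtain ⟨α, hα, hα'⟩ := exists_median hF1
  obtain ⟨β, hβ, hβ'⟩ := exists_median hG1
  let r : ℝ → ℝ≥0∞ := ENNReal.ofReal
  have hpt (x y : ℝ) : F x ^ (3 / 4 : ℝ) * G y ^ (3 / 4 : ℝ) * H (x + y) ^ (1 / 2 : ℝ) ≤
      (if (x < α ↔ y < β) then r (3 / 8) else r (9 / 16)) * (F x * G y) +
      (if (y < β ↔ x + y < α + β) then r (1 / 3) else r (4 / 27)) * (G y * H (x + y)) +
      (if (x < α ↔ x + y < α + β) then r (1 / 3) else r (4 / 27)) * (F x * H (x + y)) := by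
    have h34 (t : ℝ≥0∞) : t ^ (3 / 4 : ℝ) = t ^ (1 / 2 : ℝ) * t ^ (1 / 4 : ℝ) := by
      rw [← ENNReal.rpow_add_of_nonneg _ _ (by norm_num) (by norm_num)]; norm_num
    have h12 (t : ℝ≥0∞) : t ^ (1 / 2 : ℝ) = t ^ (1 / 4 : ℝ) * t ^ (1 / 4 : ℝ) := by
      rw [← ENNReal.rpow_add_of_nonneg _ _ (by norm_num) (by norm_num)]; norm_num
    have h : F x ^ (3 / 4 : ℝ) * G y ^ (3 / 4 : ℝ) * H (x + y) ^ (1 / 2 : ℝ) =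
        (F x * G y) ^ (1 / 2 : ℝ) * (G y * H (x + y)) ^ (1 / 4 : ℝ) *
          (F x * H (x + y)) ^ (1 / 4 : ℝ) := by
      simp only [ENNReal.mul_rpow_of_nonneg _ _ (show (0 : ℝ) ≤ 1 / 2 by norm_num),
        ENNReal.mul_rpow_of_nonneg _ _ (show (0 : ℝ) ≤ 1 / 4 by norm_num)]
      rw [h34, h34, h12 (H (x + y))]
      ring
    rw [h]
    by_cases hx : x < α <;> by_cases hy : y < β <;> by_cases hz : x + y < α + β
    all_goals
      first
        | (exfalso; linarith)
        | (simp only [hx, hy, hz, if_true, if_false, iff_self, iff_false, false_iff,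
            not_true_eq_false, r]
           exact ENNReal.geom_le_weighted_sum (by norm_num) (by norm_num) (by norm_num)
            (by norm_num) _ _ _)
  have hsum : Measurable fun x : ℝ × ℝ => x.1 + x.2 := measurable_add
  have hm1 : Measurable fun x : ℝ × ℝ =>
      (if (x.1 < α ↔ x.2 < β) then r (3 / 8) else r (9 / 16)) * (F x.1 * G x.2) :=
    (measurable_ite_iff_lt _ _ _ _).mul ((hF.comp measurable_fst).mul (hG.comp measurable_snd))
  have hm2 : Measurable fun x : ℝ × ℝ =>
      (if (x.2 < β ↔ x.1 + x.2 < α + β) then r (1 / 3) else r (4 / 27)) * (G x.2 * H (x.1 + x.2)) :=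
    ((measurable_ite_iff_lt _ _ _ _).comp (measurable_snd.prodMk hsum)).mul
      ((hG.comp measurable_snd).mul (hH.comp hsum))
  have hm3 : Measurable fun x : ℝ × ℝ =>
      (if (x.1 < α ↔ x.1 + x.2 < α + β) then r (1 / 3) else r (4 / 27)) * (F x.1 * H (x.1 + x.2)) :=
    ((measurable_ite_iff_lt _ _ _ _).comp (measurable_fst.prodMk hsum)).mul
      ((hF.comp measurable_fst).mul (hH.comp hsum))
  have e1 := lintegral_lintegral_ite_median hF hG hα hα' hG1 (r (3 / 8)) (r (9 / 16)) β
  have e2 : ∫⁻ x, ∫⁻ y, (if (y < β ↔ x + y < α + β) then r (1 / 3) else r (4 / 27)) *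
      (G y * H (x + y)) = (r (1 / 3) + r (4 / 27)) / 2 := by
    rw [lintegral_lintegral_swap hm2.aemeasurable,
      ← lintegral_lintegral_ite_median hG hH hβ hβ' hH1 (r (1 / 3)) (r (4 / 27)) (α + β)]
    congr 1 with y
    exact lintegral_add_right_eq_self (fun z => (if (y < β ↔ z < α + β) then r (1 / 3)
      else r (4 / 27)) * (G y * H z)) y
  have e3 : ∫⁻ x, ∫⁻ y, (if (x < α ↔ x + y < α + β) then r (1 / 3) else r (4 / 27)) *
      (F x * H (x + y)) = (r (1 / 3) + r (4 / 27)) / 2 := by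
    rw [← lintegral_lintegral_ite_median hF hH hα hα' hH1 (r (1 / 3)) (r (4 / 27)) (α + β)]
    congr 1 with x
    exact lintegral_add_left_eq_self (fun z => (if (x < α ↔ z < α + β) then r (1 / 3)
      else r (4 / 27)) * (F x * H z)) x
  refine (lintegral_mono fun x => lintegral_mono fun y => hpt x y).trans ?_
  have e4 (x : ℝ) : ∫⁻ y, ((if (x < α ↔ y < β) then r (3 / 8) else r (9 / 16)) * (F x * G y) +
      (if (y < β ↔ x + y < α + β) then r (1 / 3) else r (4 / 27)) * (G y * H (x + y)) +
      (if (x < α ↔ x + y < α + β) then r (1 / 3) else r (4 / 27)) * (F x * H (x + y))) =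
      (∫⁻ y, (if (x < α ↔ y < β) then r (3 / 8) else r (9 / 16)) * (F x * G y)) +
      (∫⁻ y, (if (y < β ↔ x + y < α + β) then r (1 / 3) else r (4 / 27)) * (G y * H (x + y))) +
      ∫⁻ y, (if (x < α ↔ x + y < α + β) then r (1 / 3) else r (4 / 27)) * (F x * H (x + y)) := by
    have m2 : Measurable fun y : ℝ => (if (y < β ↔ x + y < α + β) then r (1 / 3) else r (4 / 27)) *
      (G y * H (x + y)) := hm2.comp measurable_prodMk_left
    have m3 : Measurable fun y : ℝ => (if (x < α ↔ x + y < α + β) then r (1 / 3) else r (4 / 27)) *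
      (F x * H (x + y)) := hm3.comp measurable_prodMk_left
    rw [lintegral_add_right _ m3, lintegral_add_right _ m2]
  simp_rw [e4]
  rw [lintegral_add_right _ hm3.lintegral_prod_right', lintegral_add_right _ hm2.lintegral_prod_right',
    e1, e2, e3]
  simp only [r]
  rw [← ENNReal.ofReal_add (by norm_num) (by norm_num), ← ENNReal.ofReal_add (by norm_num) (by norm_num),
    ← ENNReal.ofReal_ofNat 2, ← ENNReal.ofReal_div_of_pos two_pos, ← ENNReal.ofReal_div_of_pos two_pos,
    ← ENNReal.ofReal_add (by norm_num) (by norm_num), ← ENNReal.ofReal_add (by norm_num) (by norm_num)]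
  exact ENNReal.ofReal_le_ofReal (by norm_num)

theorem youngBound_real : YoungBound ℝ (ENNReal.ofReal (24 / 25)) := by
  intro F G H hF hG hH
  have hp : (0 : ℝ) < 3 / 4 := by norm_num
  have hp' : (0 : ℝ) < 1 / 2 := by norm_num
  rcases eq_or_ne (∫⁻ x, F x) 0 with h | hF0
  · rw [lintegral_eq_zero_iff hF] at h
    refine le_of_eq_of_le ?_ zero_le
    rw [← lintegral_zero (μ := (volume : Measure ℝ))]
    refine lintegral_congr_ae ?_
    filter_upwards [h] with x hx
    simp [hx, hp]
  rcases eq_or_ne (∫⁻ x, G x) 0 with h | hG0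
  · rw [lintegral_eq_zero_iff hG] at h
    refine le_of_eq_of_le ?_ zero_le
    rw [← lintegral_zero (μ := (volume : Measure ℝ))]
    congr 1 with x
    rw [← lintegral_zero (μ := (volume : Measure ℝ))]
    refine lintegral_congr_ae ?_
    filter_upwards [h] with y hy
    simp [hy, hp]
  rcases eq_or_ne (∫⁻ x, H x) 0 with h | hH0
  · refine le_of_eq_of_le ?_ zero_le
    rw [← lintegral_zero (μ := (volume : Measure ℝ))]
    congr 1 with x
    rw [← lintegral_add_left_eq_self H x, lintegral_eq_zero_iff (by fun_prop)] at h
    rw [← lintegral_zero (μ := (volume : Measure ℝ))]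
    refine lintegral_congr_ae ?_
    filter_upwards [h] with y hy
    simp only [Pi.zero_apply] at hy
    rw [hy, ENNReal.zero_rpow_of_pos hp', mul_zero]
  have hK : ENNReal.ofReal (24 / 25) ≠ 0 := (ENNReal.ofReal_pos.2 (by norm_num)).ne'
  have hF0' := (ENNReal.rpow_pos_of_nonneg (pos_iff_ne_zero.2 hF0) hp.le).ne'
  have hG0' := (ENNReal.rpow_pos_of_nonneg (pos_iff_ne_zero.2 hG0) hp.le).ne'
  have hH0' := (ENNReal.rpow_pos_of_nonneg (pos_iff_ne_zero.2 hH0) hp'.le).ne'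
  rcases eq_or_ne (∫⁻ x, F x) ∞ with h | hFt
  · rw [h, ENNReal.top_rpow_of_pos hp, ENNReal.top_mul hG0', ENNReal.top_mul hH0', ENNReal.mul_top hK]
    exact le_top
  rcases eq_or_ne (∫⁻ x, G x) ∞ with h | hGt
  · rw [h, ENNReal.top_rpow_of_pos hp, ENNReal.mul_top hF0', ENNReal.top_mul hH0', ENNReal.mul_top hK]
    exact le_top
  rcases eq_or_ne (∫⁻ x, H x) ∞ with h | hHt
  · rw [h, ENNReal.top_rpow_of_pos hp', ENNReal.mul_top (mul_ne_zero hF0' hG0'), ENNReal.mul_top hK]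
    exact le_top
  have hn {f : ℝ → ℝ≥0∞} (hf : Measurable f) (h0 : ∫⁻ x, f x ≠ 0) (ht : ∫⁻ x, f x ≠ ∞) :
      ∫⁻ x, (∫⁻ x, f x)⁻¹ * f x = 1 := by
    rw [lintegral_const_mul _ hf, ENNReal.inv_mul_cancel h0 ht]
  have key := lintegral_young_le_of_lintegral_eq_one (hF.const_mul (∫⁻ x, F x)⁻¹)
    (hG.const_mul (∫⁻ x, G x)⁻¹) (hH.const_mul (∫⁻ x, H x)⁻¹) (hn hF hF0 hFt) (hn hG hG0 hGt)
    (hn hH hH0 hHt)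
  have hcancel {a : ℝ≥0∞} (h0 : a ≠ 0) (ht : a ≠ ∞) (t : ℝ≥0∞) (s : ℝ) (hs : 0 ≤ s) :
      t ^ s = a ^ s * (a⁻¹ * t) ^ s := by
    rw [← ENNReal.mul_rpow_of_nonneg _ _ hs, ← mul_assoc, ENNReal.mul_inv_cancel h0 ht, one_mul]
  have hpt (x y : ℝ) : F x ^ (3 / 4 : ℝ) * G y ^ (3 / 4 : ℝ) * H (x + y) ^ (1 / 2 : ℝ) =
      ((∫⁻ x, F x) ^ (3 / 4 : ℝ) * (∫⁻ x, G x) ^ (3 / 4 : ℝ) * (∫⁻ x, H x) ^ (1 / 2 : ℝ)) *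
      (((∫⁻ x, F x)⁻¹ * F x) ^ (3 / 4 : ℝ) * ((∫⁻ x, G x)⁻¹ * G y) ^ (3 / 4 : ℝ) *
        ((∫⁻ x, H x)⁻¹ * H (x + y)) ^ (1 / 2 : ℝ)) := by
    rw [hcancel hF0 hFt (F x) _ hp.le, hcancel hG0 hGt (G y) _ hp.le,
      hcancel hH0 hHt (H (x + y)) _ hp'.le]
    ring
  simp_rw [hpt]
  have hm : Measurable fun z : ℝ × ℝ => ((∫⁻ x, F x)⁻¹ * F z.1) ^ (3 / 4 : ℝ) *
      ((∫⁻ x, G x)⁻¹ * G z.2) ^ (3 / 4 : ℝ) * ((∫⁻ x, H x)⁻¹ * H (z.1 + z.2)) ^ (1 / 2 : ℝ) := by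
    fun_prop
  have e (x : ℝ) := lintegral_const_mul (μ := (volume : Measure ℝ))
    ((∫⁻ x, F x) ^ (3 / 4 : ℝ) * (∫⁻ x, G x) ^ (3 / 4 : ℝ) * (∫⁻ x, H x) ^ (1 / 2 : ℝ))
    (hm.comp (measurable_prodMk_left (x := x)))
  simp only [Function.comp_def] at e
  simp_rw [e]
  rw [lintegral_const_mul _ hm.lintegral_prod_right', mul_comm]
  gcongr

theorem YoungBound.prod {E E' : Type*} [AddCommGroup E] [AddCommGroup E'] [MeasureSpace E]
    [MeasureSpace E'] [MeasurableAdd₂ E] [MeasurableAdd₂ E'] [SigmaFinite (volume : Measure E)]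
    [SigmaFinite (volume : Measure E')] {K K' : ℝ≥0∞} (h : YoungBound E K) (h' : YoungBound E' K') :
    YoungBound (E × E') (K * K') := by
  intro F G H hF hG hH
  have hm : Measurable fun z : (E × E') × (E × E') =>
    F z.1 ^ (3 / 4 : ℝ) * G z.2 ^ (3 / 4 : ℝ) * H (z.1 + z.2) ^ (1 / 2 : ℝ) := by
    have hs : Measurable fun z : (E × E') × (E × E') => z.1 + z.2 :=
      Measurable.prodMk (f := fun z : (E × E') × (E × E') => z.1.1 + z.2.1)
        (g := fun z : (E × E') × (E × E') => z.1.2 + z.2.2) (by fun_prop) (by fun_prop)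
    exact (((hF.comp measurable_fst).pow_const _).mul ((hG.comp measurable_snd).pow_const _)).mul
      ((hH.comp hs).pow_const _)
  rw [Measure.volume_eq_prod, lintegral_prod _ hm.lintegral_prod_right'.aemeasurable]
  have e1 (x : E) : ∫⁻ x' : E', ∫⁻ y : E × E', F (x, x') ^ (3 / 4 : ℝ) * G y ^ (3 / 4 : ℝ) *
        H ((x, x') + y) ^ (1 / 2 : ℝ) ∂(volume.prod volume) =
      ∫⁻ y : E, ∫⁻ x' : E', ∫⁻ y' : E', F (x, x') ^ (3 / 4 : ℝ) * G (y, y') ^ (3 / 4 : ℝ) *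
        H (x + y, x' + y') ^ (1 / 2 : ℝ) := by
    symm
    rw [lintegral_lintegral_swap]
    · symm
      refine lintegral_congr fun x' => ?_
      rw [lintegral_prod]
      · rfl
      · exact (hm.comp measurable_prodMk_left).aemeasurable
    · refine Measurable.aemeasurable ?_
      refine Measurable.lintegral_prod_right' (f := fun z : (E × E') × E' =>
        F (x, z.1.2) ^ (3 / 4 : ℝ) * G (z.1.1, z.2) ^ (3 / 4 : ℝ) *
        H (x + z.1.1, z.1.2 + z.2) ^ (1 / 2 : ℝ)) ?_
      fun_prop
  simp_rw [e1]
  have hF' : Measurable fun x => ∫⁻ x', F (x, x') := hF.lintegral_prod_right'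
  have hG' : Measurable fun x => ∫⁻ x', G (x, x') := hG.lintegral_prod_right'
  have hH' : Measurable fun x => ∫⁻ x', H (x, x') := hH.lintegral_prod_right'
  have h2 := h _ _ _ hF' hG' hH'
  rw [lintegral_prod _ hF.aemeasurable, lintegral_prod _ hG.aemeasurable,
    lintegral_prod _ hH.aemeasurable]
  have hm2 : Measurable fun z : E × E => (∫⁻ x', F (z.1, x')) ^ (3 / 4 : ℝ) *
      (∫⁻ x', G (z.2, x')) ^ (3 / 4 : ℝ) * (∫⁻ x', H (z.1 + z.2, x')) ^ (1 / 2 : ℝ) := by fun_prop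
  calc _ ≤ ∫⁻ x : E, ∫⁻ y : E, K' * ((∫⁻ x', F (x, x')) ^ (3 / 4 : ℝ) *
        (∫⁻ x', G (y, x')) ^ (3 / 4 : ℝ) * (∫⁻ x', H (x + y, x')) ^ (1 / 2 : ℝ)) := by
        refine lintegral_mono fun x => lintegral_mono fun y => ?_
        exact h' (fun x' => F (x, x')) (fun y' => G (y, y')) (fun z' => H (x + y, z'))
          (by fun_prop) (by fun_prop) (by fun_prop)
    _ = K' * ∫⁻ x : E, ∫⁻ y : E, ((∫⁻ x', F (x, x')) ^ (3 / 4 : ℝ) *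
        (∫⁻ x', G (y, x')) ^ (3 / 4 : ℝ) * (∫⁻ x', H (x + y, x')) ^ (1 / 2 : ℝ)) := by
        rw [← lintegral_const_mul _ hm2.lintegral_prod_right']
        refine lintegral_congr fun x => ?_
        exact lintegral_const_mul _ (hm2.comp measurable_prodMk_left)
    _ ≤ _ := by
        rw [mul_comm K, mul_assoc]
        gcongr

theorem YoungBound.of_measurePreserving {E E' : Type*} [Add E] [Add E'] [MeasureSpace E]
    [MeasureSpace E'] {K : ℝ≥0∞} (h : YoungBound E K) (e : E ≃ᵐ E')
    (he : MeasurePreserving e) (hadd : ∀ x y, e (x + y) = e x + e y) : YoungBound E' K := by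
  intro F G H hF hG hH
  have := h _ _ _ (hF.comp e.measurable) (hG.comp e.measurable) (hH.comp e.measurable)
  simp only [Function.comp_apply, hadd] at this
  rw [← he.map_eq]
  simp only [lintegral_map_equiv]
  exact this

theorem youngBound_pi (n : ℕ) : YoungBound (Fin n → ℝ) (ENNReal.ofReal (24 / 25) ^ n) := by
  induction n with
  | zero =>
    intro F G H _ _ _
    have h (x y : Fin 0 → ℝ) : H (x + y) = H y := congrArg H (Subsingleton.elim _ _)
    simp_rw [h]
    simp [lintegral_unique, Measure.volume_pi_eq_dirac (0 : Fin 0 → ℝ)]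
  | succ n ih =>
    rw [pow_succ']
    refine (youngBound_real.prod ih).of_measurePreserving
      (MeasurableEquiv.piFinSuccAbove (fun _ => ℝ) 0).symm
      (volume_preserving_piFinSuccAbove (fun _ => ℝ) 0).symm fun x y => ?_
    ext i
    refine Fin.cases ?_ (fun i => ?_) i <;>
      simp [MeasurableEquiv.piFinSuccAbove]

theorem lintegral_lintegral_add_le {n : ℕ} {A B : Set (Fin n → ℝ)} (hA : MeasurableSet A)
    (hB : MeasurableSet B) {v : ℝ≥0∞} (hAv : volume A ≤ v) (hBv : volume B ≤ v)
    {h : (Fin n → ℝ) → ℝ≥0∞} (hh : Measurable h) :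
    ∫⁻ x in A, ∫⁻ y in B, h (x + y) ≤
      ENNReal.ofReal (24 / 25) ^ n * (v ^ (3 / 2 : ℝ) * (∫⁻ x, h x ^ 2) ^ (1 / 2 : ℝ)) := by
  have key := youngBound_pi n (A.indicator 1) (B.indicator 1) (fun x => h x ^ 2)
    (measurable_one.indicator hA) (measurable_one.indicator hB) (hh.pow_const 2)
  have hind (A : Set (Fin n → ℝ)) (x : Fin n → ℝ) :
      A.indicator (1 : (Fin n → ℝ) → ℝ≥0∞) x ^ (3 / 4 : ℝ) = A.indicator 1 x := by
    by_cases hx : x ∈ A <;> simp [hx]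
  have hsq (t : ℝ≥0∞) : (t ^ 2) ^ (1 / 2 : ℝ) = t := by
    rw [← ENNReal.rpow_natCast, ← ENNReal.rpow_mul]; norm_num
  simp only [hind, hsq, lintegral_indicator_one hA, lintegral_indicator_one hB] at key
  have hl : ∫⁻ x in A, ∫⁻ y in B, h (x + y) =
      ∫⁻ x, ∫⁻ y, A.indicator 1 x * B.indicator 1 y * h (x + y) := by
    rw [← lintegral_indicator hA]
    refine lintegral_congr fun x => ?_
    by_cases hx : x ∈ A
    · simp only [hx, Set.indicator_of_mem, Pi.one_apply, one_mul]
      rw [← lintegral_indicator hB]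
      refine lintegral_congr fun y => ?_
      by_cases hy : y ∈ B <;> simp [hy]
    · simp [hx]
  rw [hl]
  refine key.trans ?_
  have hv : v ^ (3 / 2 : ℝ) = v ^ (3 / 4 : ℝ) * v ^ (3 / 4 : ℝ) := by
    rw [← ENNReal.rpow_add_of_nonneg _ _ (by norm_num) (by norm_num)]; norm_num
  rw [hv]
  gcongr

theorem lintegral_indicator_add_le_two {n : ℕ} {A B D : Set (Fin n → ℝ)} (hA : MeasurableSet A)
    (hB : MeasurableSet B) (hD : MeasurableSet D) {v : ℝ≥0∞} (hAv : volume A ≤ v)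
    (hBv : volume B ≤ v) (hDv : volume D ≤ v) :
    ∫⁻ x in A, ∫⁻ y in B, D.indicator 1 (x + y) ≤ ENNReal.ofReal (24 / 25) ^ n * v ^ 2 := by
  refine (lintegral_lintegral_add_le hA hB hAv hBv (measurable_one.indicator hD)).trans ?_
  have hind (x : Fin n → ℝ) : D.indicator (1 : (Fin n → ℝ) → ℝ≥0∞) x ^ 2 = D.indicator 1 x := by
    by_cases hx : x ∈ D <;> simp [hx]
  simp only [hind, lintegral_indicator_one hD]
  have hv : v ^ 2 = v ^ (3 / 2 : ℝ) * v ^ (1 / 2 : ℝ) := by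
    rw [← ENNReal.rpow_add_of_nonneg _ _ (by norm_num) (by norm_num), ← ENNReal.rpow_natCast]
    norm_num
  rw [hv]
  gcongr

theorem lintegral_indicator_add_le_three {n : ℕ} {A B C D : Set (Fin n → ℝ)} (hA : MeasurableSet A)
    (hB : MeasurableSet B) (hC : MeasurableSet C) (hD : MeasurableSet D) {v : ℝ≥0∞} (hv : v ≠ ∞)
    (hAv : volume A ≤ v) (hBv : volume B ≤ v) (hCv : volume C ≤ v) (hDv : volume D ≤ v) :
    ∫⁻ x in A, ∫⁻ y in B, ∫⁻ z in C, D.indicator 1 (x + y + z) ≤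
      (ENNReal.ofReal (24 / 25) ^ n) ^ 2 * v ^ 3 := by
  let h : (Fin n → ℝ) → ℝ≥0∞ := fun w => ∫⁻ z in C, D.indicator 1 (w + z)
  have hD1 : Measurable (D.indicator (1 : (Fin n → ℝ) → ℝ≥0∞)) := measurable_one.indicator hD
  have hm : Measurable fun z : (Fin n → ℝ) × (Fin n → ℝ) =>
      D.indicator (1 : (Fin n → ℝ) → ℝ≥0∞) (z.1 + z.2) := by fun_prop
  have hh : Measurable h := hm.lintegral_prod_right'
  have hle (w) : h w ≤ v := by
    refine (lintegral_mono (g := 1) fun z => ?_).trans ?_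
    · exact Set.indicator_le_self _ _ _
    · simpa using hCv
  have hint : ∫⁻ w, h w ≤ v * v := by
    simp only [h]
    rw [lintegral_lintegral_swap (by exact hm.aemeasurable)]
    have e (z : Fin n → ℝ) : ∫⁻ w, D.indicator (1 : (Fin n → ℝ) → ℝ≥0∞) (w + z) = volume D := by
      rw [lintegral_add_right_eq_self (D.indicator (1 : (Fin n → ℝ) → ℝ≥0∞)) z,
        lintegral_indicator_one hD]
    simp_rw [e]
    rw [setLIntegral_const]
    gcongr
  have hfin : ∫⁻ w, h w ^ 2 ≠ ∞ := by
    refine ne_top_of_le_ne_top (b := v * (v * v)) (by finiteness) ?_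
    calc ∫⁻ w, h w ^ 2 ≤ ∫⁻ w, v * h w := lintegral_mono fun w => by
          rw [sq]; gcongr; exact hle w
      _ = v * ∫⁻ w, h w := lintegral_const_mul _ hh
      _ ≤ _ := by gcongr
  have hT : ∫⁻ w, h w ^ 2 = ∫⁻ d in D, ∫⁻ y in -C, h (d + y) := by
    have e1 (w) : h w ^ 2 = ∫⁻ z in C, h w * D.indicator 1 (w + z) := by
      rw [lintegral_const_mul _ (by fun_prop), sq]
    simp_rw [e1]
    rw [lintegral_lintegral_swap (by fun_prop)]
    have e2 (z) : ∫⁻ w, h w * D.indicator 1 (w + z) = ∫⁻ d in D, h (d + -z) := by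
      rw [← lintegral_add_right_eq_self _ (-z), ← lintegral_indicator hD]
      refine lintegral_congr fun d => ?_
      by_cases hd : d ∈ D <;> simp [hd]
    simp_rw [e2]
    rw [lintegral_lintegral_swap (by fun_prop)]
    refine lintegral_congr fun d => ?_
    have := (Measure.measurePreserving_neg (volume : Measure (Fin n → ℝ))).setLIntegral_comp_preimage_emb
      (MeasurableEquiv.neg _).measurableEmbedding (fun y => h (d + y)) (-C)
    rw [← this]
    simp
  have hK : ∫⁻ w, h w ^ 2 ≤ ENNReal.ofReal (24 / 25) ^ n * (v ^ (3 / 2 : ℝ) *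
      (∫⁻ x, h x ^ 2) ^ (1 / 2 : ℝ)) := by
    conv_lhs => rw [hT]
    exact lintegral_lintegral_add_le hD hC.neg hDv (by rwa [Measure.measure_neg]) hh
  have hT2 : (∫⁻ w, h w ^ 2) ^ (1 / 2 : ℝ) ≤ ENNReal.ofReal (24 / 25) ^ n * v ^ (3 / 2 : ℝ) := by
    set T := ∫⁻ w, h w ^ 2
    have hTs : T = T ^ (1 / 2 : ℝ) * T ^ (1 / 2 : ℝ) := by
      rw [← ENNReal.rpow_add_of_nonneg _ _ (by norm_num) (by norm_num)]; norm_num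
    rcases eq_or_ne T 0 with h0 | h0
    · simp [h0]
    · rw [← mul_assoc] at hK
      nth_rewrite 1 [hTs] at hK
      refine (ENNReal.mul_le_mul_iff_left ?_ ?_).1 hK
      · simp [h0]
      · exact ENNReal.rpow_ne_top_of_nonneg (by norm_num) hfin
  refine (lintegral_lintegral_add_le hA hB hAv hBv hh).trans ?_
  calc _ ≤ ENNReal.ofReal (24 / 25) ^ n * (v ^ (3 / 2 : ℝ) *
        (ENNReal.ofReal (24 / 25) ^ n * v ^ (3 / 2 : ℝ))) := by gcongr
    _ = (ENNReal.ofReal (24 / 25) ^ n) ^ 2 * (v ^ (3 / 2 : ℝ) * v ^ (3 / 2 : ℝ)) := by ring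
    _ = _ := by
      rw [← ENNReal.rpow_add_of_nonneg _ _ (by norm_num) (by norm_num), ← ENNReal.rpow_natCast v]
      norm_num

theorem exists_setLIntegral_sign {n : ℕ} {p : ℤ} (hp : p = 1 ∨ p = -1) {O : Set (Fin n → ℝ)}
    (hO : MeasurableSet O) :
    ∃ A, MeasurableSet A ∧ volume A = volume O ∧
      ∀ f : (Fin n → ℝ) → ℝ≥0∞, ∫⁻ x in O, f (p • x) = ∫⁻ x in A, f x := by
  rcases hp with rfl | rfl
  · exact ⟨O, hO, rfl, fun f => by simp⟩
  · refine ⟨-O, hO.neg, Measure.measure_neg _ _, fun f => ?_⟩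
    have := (Measure.measurePreserving_neg (volume : Measure (Fin n → ℝ))).setLIntegral_comp_preimage_emb
      (MeasurableEquiv.neg _).measurableEmbedding f (-O)
    rw [← this]
    simp

/-- Tuples in `O` such that `w` plus the combination with coefficients `p` is again in `O`. -/
def relationSet {m n : ℕ} (p : Fin m → ℤ) (O : Set (Fin n → ℝ)) (w : Fin n → ℝ) :
    Set (Fin m → Fin n → ℝ) :=
  {x | (∀ i, x i ∈ O) ∧ w + ∑ i, p i • x i ∈ O}

theorem measurableSet_relationSet {m n : ℕ} (p : Fin m → ℤ) {O : Set (Fin n → ℝ)}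
    (hO : MeasurableSet O) (w : Fin n → ℝ) : MeasurableSet (relationSet p O w) := by
  refine MeasurableSet.inter (s₁ := {x : Fin m → Fin n → ℝ | ∀ i, x i ∈ O}) ?_ ?_
  · simp only [Set.ofPred_forall]
    exact MeasurableSet.iInter fun i => hO.preimage (measurable_pi_apply i)
  · exact hO.preimage (f := fun x : Fin m → Fin n → ℝ => w + ∑ i, p i • x i) (by fun_prop)

theorem volume_relationSet_zero {n : ℕ} (p : Fin 0 → ℤ) (O : Set (Fin n → ℝ)) (w : Fin n → ℝ) :
    volume (relationSet p O w) = O.indicator 1 w := by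
  by_cases hw : w ∈ O
  · have : relationSet p O w = Set.univ := by ext; simp [relationSet, hw]
    simp [this, hw, Measure.volume_pi_eq_dirac (0 : Fin 0 → Fin n → ℝ)]
  · have : relationSet p O w = ∅ := by ext; simp [relationSet, hw]
    simp [this, hw]

theorem volume_relationSet_succ {m n : ℕ} (p : Fin (m + 1) → ℤ) {O : Set (Fin n → ℝ)}
    (hO : MeasurableSet O) (w : Fin n → ℝ) :
    volume (relationSet p O w) =
      ∫⁻ x in O, volume (relationSet (fun i => p i.succ) O (w + p 0 • x)) := by
  have e := (volume_preserving_piFinSuccAbove (fun _ : Fin (m + 1) => Fin n → ℝ) 0).symm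
  rw [← e.measure_preimage (measurableSet_relationSet p hO w).nullMeasurableSet,
    Measure.volume_eq_prod,
    Measure.prod_apply ((measurableSet_relationSet p hO w).preimage (MeasurableEquiv.measurable _)),
    ← lintegral_indicator hO]
  refine lintegral_congr fun x => ?_
  by_cases hx : x ∈ O
  · rw [Set.indicator_of_mem hx]
    congr 1
    ext y
    simp [relationSet, MeasurableEquiv.piFinSuccAbove, Fin.forall_fin_succ, Fin.sum_univ_succ, hx,
      add_assoc]
  · rw [Set.indicator_of_notMem hx]
    refine measure_mono_null (t := ∅) (fun y hy => ?_) measure_empty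
    refine hx ?_
    have := hy.1 0
    simpa [MeasurableEquiv.piFinSuccAbove] using this

theorem volume_relationSet_two_le {n : ℕ} {p : Fin 2 → ℤ} (hp : ∀ i, p i = 1 ∨ p i = -1)
    {O : Set (Fin n → ℝ)} (hO : MeasurableSet O) (w : Fin n → ℝ) :
    volume (relationSet p O w) ≤ ENNReal.ofReal (24 / 25) ^ n * volume O ^ 2 := by
  obtain ⟨A, hA, hAv, hAf⟩ := exists_setLIntegral_sign (hp 0) hO
  obtain ⟨B, hB, hBv, hBf⟩ := exists_setLIntegral_sign (hp 1) hO
  have hD : MeasurableSet ((fun x => w + x) ⁻¹' O) := hO.preimage (measurable_const_add w)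
  rw [volume_relationSet_succ p hO]
  simp_rw [volume_relationSet_succ _ hO, volume_relationSet_zero]
  simp only [Fin.succ_zero_eq_one]
  rw [hAf fun x => ∫⁻ y in O, O.indicator 1 (w + x + p 1 • y)]
  simp_rw [fun x => hBf fun y => O.indicator 1 (w + x + y)]
  convert lintegral_indicator_add_le_two hA hB hD hAv.le hBv.le
    (measure_preimage_add _ _ _).le using 5
  rw [add_assoc]
  rfl

theorem volume_relationSet_three_le {n : ℕ} {p : Fin 3 → ℤ} (hp : ∀ i, p i = 1 ∨ p i = -1)
    {O : Set (Fin n → ℝ)} (hO : MeasurableSet O) (hOv : volume O ≠ ∞) (w : Fin n → ℝ) :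
    volume (relationSet p O w) ≤ (ENNReal.ofReal (24 / 25) ^ n) ^ 2 * volume O ^ 3 := by
  obtain ⟨A, hA, hAv, hAf⟩ := exists_setLIntegral_sign (hp 0) hO
  obtain ⟨B, hB, hBv, hBf⟩ := exists_setLIntegral_sign (hp 1) hO
  obtain ⟨C, hC, hCv, hCf⟩ := exists_setLIntegral_sign (hp 2) hO
  have hD : MeasurableSet ((fun x => w + x) ⁻¹' O) := hO.preimage (measurable_const_add w)
  rw [volume_relationSet_succ p hO]
  simp_rw [volume_relationSet_succ _ hO, volume_relationSet_zero]
  simp only [Fin.succ_zero_eq_one, Fin.succ_one_eq_two]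
  rw [hAf fun x => ∫⁻ y in O, ∫⁻ z in O, O.indicator 1 (w + x + p 1 • y + p 2 • z)]
  simp_rw [fun x => hBf fun y => ∫⁻ z in O, O.indicator 1 (w + x + y + p 2 • z),
    fun x y => hCf fun z => O.indicator 1 (w + x + y + z)]
  convert lintegral_indicator_add_le_three hA hB hC hD hOv hAv.le hBv.le hCv.le
    (measure_preimage_add _ _ _).le using 7
  simp only [add_assoc]
  rfl

theorem volume_relationSet_le {m n : ℕ} (hm : 3 ≤ m) {p : Fin m → ℤ} (hp : ∀ i, p i = 1 ∨ p i = -1)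
    {O : Set (Fin n → ℝ)} (hO : MeasurableSet O) (hOv : volume O ≠ ∞) (w : Fin n → ℝ) :
    volume (relationSet p O w) ≤ (ENNReal.ofReal (24 / 25) ^ n) ^ 2 * volume O ^ m := by
  induction m, hm using Nat.le_induction generalizing w with
  | base => exact volume_relationSet_three_le hp hO hOv w
  | succ m hm ih =>
    rw [volume_relationSet_succ p hO]
    refine (lintegral_mono fun x => ih (fun i => hp i.succ) _).trans ?_
    rw [setLIntegral_const, pow_succ (volume O), mul_assoc]

/-- A dependent set of integer vectors carries a primitive relation whose members other than
the one with the largest coefficient are independent. -/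
theorem exists_primitive_relation {n : ℕ} {V : Set (Fin n → ℤ)}
    (hV : ¬ LinearIndependent ℤ (fun x : V => (x : Fin n → ℤ))) :
    ∃ (m : ℕ) (v : Fin m → Fin n → ℤ) (d : Fin n → ℤ) (p c : Fin m → ℤ) (q : ℕ),
      (∀ i, v i ∈ V) ∧ d ∈ V ∧ LinearIndependent ℤ v ∧ d ∉ Set.range v ∧ q ≠ 0 ∧
      (∀ i, p i ≠ 0 ∧ |p i| ≤ q) ∧ (q : ℤ) ∣ ∑ i, p i * c i - 1 ∧ ∑ i, p i • v i = (q : ℤ) • d := by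
  classical
  have hex : ∃ N : ℕ, ∃ w : Fin N → Fin n → ℤ, Function.Injective w ∧ (∀ i, w i ∈ V) ∧
      ¬ LinearIndependent ℤ w := by
    rw [linearIndependent_iff_finset_linearIndependent] at hV
    push Not at hV
    obtain ⟨s, hs⟩ := hV
    refine ⟨s.card, fun i => ((s.equivFin.symm i : s) : V), ?_, fun i => Subtype.property _, ?_⟩
    · exact Subtype.val_injective.comp (Subtype.val_injective.comp s.equivFin.symm.injective)
    · intro h
      refine hs ?_
      have := h.comp s.equivFin s.equivFin.injective
      convert this using 1
      ext1 x
      simp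
  obtain ⟨w, hwi, hwV, hw⟩ := Nat.find_spec hex
  have hmin := fun k => Nat.find_min (m := k) hex
  generalize Nat.find hex = N at *
  obtain _ | m := N
  · exact absurd linearIndependent_empty_type hw
  have hLI (i : Fin (m + 1)) : LinearIndependent ℤ (w ∘ i.succAbove) := by
    by_contra h
    exact hmin m (Nat.lt_succ_self m) ⟨_, hwi.comp i.succAbove_right_injective, fun _ => hwV _, h⟩
  rw [Fintype.linearIndependent_iff] at hw
  push Not at hw
  obtain ⟨a, ha, i₁, hi₁⟩ := hw
  obtain ⟨b, hb, hb1⟩ := Finset.extract_gcd a (Finset.univ_nonempty (α := Fin (m + 1)))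
  have hd : Finset.univ.gcd a ≠ 0 := fun h => hi₁ (by rw [hb i₁ (Finset.mem_univ _), h, zero_mul])
  have hbw : ∑ i, b i • w i = 0 := by
    have : Finset.univ.gcd a • ∑ i, b i • w i = 0 := by
      rw [Finset.smul_sum, ← ha]
      refine Finset.sum_congr rfl fun i hi => ?_
      rw [smul_smul, ← hb i hi]
    exact (smul_eq_zero.1 this).resolve_left hd
  have hbi₁ : b i₁ ≠ 0 := fun h => hi₁ (by rw [hb i₁ (Finset.mem_univ _), h, mul_zero])
  have hb0 (i) : b i ≠ 0 := by
    intro h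
    rw [Fin.sum_univ_succAbove _ i, h, zero_smul, zero_add] at hbw
    have h0 := Fintype.linearIndependent_iff.1 (hLI i) (fun j => b (i.succAbove j)) hbw
    obtain rfl | h1 := eq_or_ne i₁ i
    · exact hbi₁ h
    · obtain ⟨j, rfl⟩ := Fin.exists_succAbove_eq h1
      exact hbi₁ (h0 j)
  obtain ⟨c, hc⟩ := Finset.gcd_eq_sum_mul Finset.univ b
  rw [hb1] at hc
  obtain ⟨i₀, -, hi₀⟩ := Finset.exists_max_image Finset.univ (fun i => |b i|) Finset.univ_nonempty
  rw [Fin.sum_univ_succAbove _ i₀] at hbw hc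
  have hs : (b i₀).sign * (b i₀).sign = 1 := by
    rw [← Int.sign_mul, Int.sign_eq_one_of_pos (mul_self_pos.2 (hb0 i₀))]
  refine ⟨m, w ∘ i₀.succAbove, w i₀, fun j => -(b i₀).sign * b (i₀.succAbove j),
    fun j => -(b i₀).sign * c (i₀.succAbove j), (b i₀).natAbs, fun _ => hwV _, hwV _, hLI i₀,
    ?_, by simpa using hb0 i₀, fun j => ⟨?_, ?_⟩, ?_, ?_⟩
  · rintro ⟨j, hj⟩
    exact i₀.succAbove_ne j (hwi hj)
  · refine mul_ne_zero (neg_ne_zero.2 ?_) (hb0 _)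
    simpa using hb0 i₀
  · rw [abs_mul, abs_neg, Int.abs_sign_of_ne_zero (hb0 i₀), one_mul, Int.natCast_natAbs]
    exact hi₀ _ (Finset.mem_univ _)
  · rw [Int.natAbs_dvd]
    refine ⟨-c i₀, ?_⟩
    have : ∑ j, -(b i₀).sign * b (i₀.succAbove j) * (-(b i₀).sign * c (i₀.succAbove j)) =
        ∑ j, b (i₀.succAbove j) * c (i₀.succAbove j) :=
      Finset.sum_congr rfl fun j _ => by linear_combination b (i₀.succAbove j) * c (i₀.succAbove j) * hs
    rw [this]
    linear_combination -hc
  · have h1 : ∑ j, b (i₀.succAbove j) • w (i₀.succAbove j) = -(b i₀ • w i₀) :=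
      eq_neg_of_add_eq_zero_right hbw
    simp only [mul_smul, ← Finset.smul_sum, Function.comp_apply, h1]
    rw [smul_neg, neg_smul, neg_neg, smul_smul, Int.sign_mul_self_eq_abs, Int.natCast_natAbs]

open Matrix in
theorem linearIndependent_tupleMap {m n : ℕ} {u : Fin m → Fin n → ℤ} (hu : LinearIndependent ℤ u)
    (g : SLR n) : LinearIndependent ℝ (tupleMap g (tupleCast u)) := by
  have hg : Function.Injective g.1.mulVecLin :=
    mulVec_injective_of_det_ne_zero (by rw [g.2]; exact one_ne_zero)
  refine LinearIndependent.map' (v := tupleCast u) ?_ g.1.mulVecLin (LinearMap.ker_eq_bot.2 hg)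
  rw [Fintype.linearIndependent_iff]
  intro a ha
  let R : Matrix (Fin m) (Fin n) ℝ := (Matrix.of u).map (Int.castRingHom ℝ)
  have hdet : (R * Rᵀ).det ≠ 0 := by
    have : R * Rᵀ = (Matrix.of u * (Matrix.of u)ᵀ).map (Int.castRingHom ℝ) := by
      rw [Matrix.map_mul, ← transpose_map]
    rw [this, ← RingHom.mapMatrix_apply, ← RingHom.map_det]
    simpa using det_mul_transpose_ne_zero hu
  have h0 : a ᵥ* R = 0 := by
    rw [← ha]
    ext j
    simp [vecMul, dotProduct, R, tupleCast]
  refine congrFun (eq_zero_of_vecMul_eq_zero hdet ?_)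
  rw [← vecMul_vecMul, h0, zero_vecMul]

/-- A tuple counted by one of finitely many counts, permuted in all ways, contributes `m!`. -/
theorem factorial_le_sum_latticeCount {m n q : ℕ} {P : Finset (Fin m → ℤ)}
    (hP : ∀ p ∈ P, ∀ σ : Equiv.Perm (Fin m), p ∘ σ ∈ P)
    {W : (Fin m → ℤ) → Set (Fin m → Fin n → ℝ)}
    (hW : ∀ p x, ∀ σ : Equiv.Perm (Fin m), x ∈ W p → x ∘ σ ∈ W (p ∘ σ)) {g : SLR n}
    {v : Fin m → Fin n → ℤ} {p : Fin m → ℤ} (hp : p ∈ P) (hv : v ∈ admissibleTuples n p q)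
    (hvW : tupleMap g (tupleCast v) ∈ W p) :
    (m.factorial : ℝ≥0∞) ≤ ∑ p ∈ P, latticeCount (admissibleTuples n p q) (W p) g := by
  classical
  have hinj : Function.Injective fun σ : Equiv.Perm (Fin m) => v ∘ σ := fun σ τ h =>
    Equiv.ext fun i => hv.1.injective (congrFun h i)
  simp only [latticeCount]
  rw [← Summable.tsum_finsetSum fun _ _ => ENNReal.summable]
  refine le_trans ?_ (ENNReal.sum_le_tsum (Finset.univ.map ⟨_, hinj⟩))
  rw [Finset.sum_map]
  have hcard : (m.factorial : ℝ≥0∞) = ∑ _σ : Equiv.Perm (Fin m), (1 : ℝ≥0∞) := by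
    simp [Fintype.card_perm]
  rw [hcard]
  refine Finset.sum_le_sum fun σ _ => ?_
  refine le_trans ?_ (Finset.single_le_sum (fun _ _ => zero_le) (hP p hp σ))
  rw [Set.indicator_of_mem]
  · rfl
  · refine ⟨⟨hv.1.comp σ σ.injective, fun j => ?_⟩, hW p _ σ hvW⟩
    have := hv.2 j
    rw [← Equiv.sum_comp σ] at this
    exact this

open scoped Classical in
/-- The tuples of nonzero integers of size at most `q` which are unimodular modulo `q`. -/
def coeffSet (m q : ℕ) : Finset (Fin m → ℤ) :=
  (Fintype.piFinset fun _ => (Finset.Icc (-q : ℤ) q).erase 0).filter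
    fun p : Fin m → ℤ => ∃ c : Fin m → ℤ, (q : ℤ) ∣ ∑ i, p i * c i - 1

theorem mem_coeffSet {m q : ℕ} {p : Fin m → ℤ} : p ∈ coeffSet m q ↔
    (∀ i, p i ≠ 0 ∧ |p i| ≤ q) ∧ ∃ c : Fin m → ℤ, (q : ℤ) ∣ ∑ i, p i * c i - 1 := by
  simp [coeffSet, abs_le]

theorem comp_mem_coeffSet {m q : ℕ} {p : Fin m → ℤ} (hp : p ∈ coeffSet m q)
    (σ : Equiv.Perm (Fin m)) : p ∘ σ ∈ coeffSet m q := by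
  rw [mem_coeffSet] at hp ⊢
  obtain ⟨h1, c, hc⟩ := hp
  refine ⟨fun i => h1 _, c ∘ σ, ?_⟩
  rwa [← Equiv.sum_comp σ] at hc

theorem card_coeffSet_le (m q : ℕ) : (coeffSet m q).card ≤ (2 * q) ^ m := by
  classical
  refine (Finset.card_filter_le _ _).trans ?_
  rw [Fintype.card_piFinset]
  simp only [Finset.prod_const, Finset.card_univ, Fintype.card_fin]
  rw [Finset.card_erase_of_mem (by simp), Int.card_Icc]
  gcongr
  omega

theorem comp_mem_relationSet {m n : ℕ} {O : Set (Fin n → ℝ)} {w : Fin n → ℝ} (p : Fin m → ℤ)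
    (x : Fin m → Fin n → ℝ) (σ : Equiv.Perm (Fin m)) (hx : x ∈ relationSet p O w) :
    x ∘ σ ∈ relationSet (p ∘ σ) O w := by
  refine ⟨fun i => hx.1 _, ?_⟩
  have := hx.2
  rw [← Equiv.sum_comp σ] at this
  exact this

/-- If the points of the lattice `g ℤⁿ` in `S` are too many or dependent, then one of the counts
of independent integer tuples is at least a factorial. -/
theorem indepSet_or_factorial_le {n : ℕ} {S O : Set (Fin n → ℝ)} (hSO : S ⊆ O)
    (hS : S ∩ (-S) = ∅) (g : SLR n) {k : ℕ} {X : Set (Fin n → ℝ)}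
    (hX : X = {y | ∃ v : Fin n → ℤ, y = g.1.mulVec (fun i => (v i : ℝ))} ∩ S) :
    (X.Finite ∧ X.ncard < k ∧ indepSet X) ∨
    (k.factorial : ℝ≥0∞) ≤
      latticeCount (admissibleTuples n (0 : Fin k → ℤ) 1) {x | ∀ i, x i ∈ O} g ∨
    (∃ m < k, ∃ q, 2 ≤ q ∧ (m.factorial : ℝ≥0∞) ≤
      ∑ p ∈ coeffSet m q, latticeCount (admissibleTuples n p q) {x | ∀ i, x i ∈ O} g) ∨
    ∃ m < k, 2 ≤ m ∧ (m.factorial : ℝ≥0∞) ≤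
      ∑ p ∈ coeffSet m 1, latticeCount (admissibleTuples n p 1) (relationSet p O 0) g := by
  classical
  let f : (Fin n → ℤ) → (Fin n → ℝ) := fun v => g.1.mulVec (fun i => (v i : ℝ))
  have hf : Function.Injective f := by
    refine (Matrix.mulVec_injective_of_det_ne_zero (M := g.1)
      (by rw [g.2]; exact one_ne_zero)).comp fun v w h => ?_
    ext i
    exact_mod_cast congrFun h i
  have hfneg (v) : f (-v) = -f v := by
    simp only [f, ← Matrix.mulVec_neg]
    congr 1
    ext i
    simp
  have hS' (x) (h1 : x ∈ S) (h2 : -x ∈ S) : False := by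
    have : x ∈ S ∩ (-S) := ⟨h1, h2⟩
    rw [hS] at this
    exact this
  let V : Set (Fin n → ℤ) := f ⁻¹' S
  have hXV : X = f '' V := by
    rw [hX, Set.image_preimage_eq_inter_range, Set.inter_comm]
    congr 1
    ext y
    simp [f, eq_comm]
  have hlarge {m : ℕ} (hm : k ≤ m) {v : Fin m → Fin n → ℤ} (hv : LinearIndependent ℤ v)
      (hvV : ∀ i, v i ∈ V) : (k.factorial : ℝ≥0∞) ≤
      latticeCount (admissibleTuples n (0 : Fin k → ℤ) 1) {x | ∀ i, x i ∈ O} g := by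
    have := factorial_le_sum_latticeCount (P := {0}) (q := 1) (p := 0)
      (W := fun _ => {x : Fin k → Fin n → ℝ | ∀ i, x i ∈ O}) (g := g)
      (v := v ∘ Fin.castLE hm) (by simp) (fun p x σ hx i => hx _) (by simp)
      ⟨hv.comp _ (Fin.castLE_injective hm), fun j => by simp⟩ (fun i => hSO (hvV _))
    simpa using this
  by_cases hV : LinearIndependent ℤ (fun x : V => (x : Fin n → ℤ))
  · by_cases hk : V.Finite ∧ V.ncard < k
    · left
      refine ⟨hXV ▸ hk.1.image f, ?_, ?_⟩
      · rw [hXV, Set.ncard_image_of_injective _ hf]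
        exact hk.2
      · have := hk.1.fintype
        let e := Fintype.equivFin V
        have h1 := linearIndependent_tupleMap (hV.comp e.symm e.symm.injective) g
        have h2 := h1.comp e e.injective
        have h3 := h2.linearIndepOn_id
        rw [indepSet, hXV]
        have hval (x : V) : tupleMap g (tupleCast ((fun x : V => (x : Fin n → ℤ)) ∘ e.symm)) (e x) =
            f x := by
          change f (e.symm (e x)) = f x
          rw [Equiv.symm_apply_apply]
        have h4 : Set.range (tupleMap g (tupleCast ((fun x : V => (x : Fin n → ℤ)) ∘ e.symm)) ∘ e) =
            f '' V := by
          rw [Set.image_eq_range]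
          exact congrArg Set.range (funext hval)
        rw [h4] at h3
        exact h3
    · right; left
      obtain ⟨t, ht, htk⟩ : ∃ t : Finset (Fin n → ℤ), (t : Set _) ⊆ V ∧ t.card = k := by
        by_cases hfin : V.Finite
        · have hk' : k ≤ hfin.toFinset.card := by
            rw [← Set.ncard_eq_toFinset_card _ hfin]
            exact not_lt.1 fun h => hk ⟨hfin, h⟩
          obtain ⟨t, ht, h⟩ := Finset.exists_subset_card_eq hk'
          exact ⟨t, fun x hx => by simpa using ht hx, h⟩
        · exact Set.Infinite.exists_subset_card_eq hfin k
      let e := t.equivFinOfCardEq htk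
      refine hlarge le_rfl (v := fun i => (e.symm i : Fin n → ℤ)) ?_ fun i => ht (e.symm i).2
      exact hV.comp (fun i => ⟨_, ht (e.symm i).2⟩) fun i j h =>
        e.symm.injective (Subtype.ext (congrArg (fun x : V => (x : Fin n → ℤ)) h))
  · right
    obtain ⟨m, v, d, p, c, q, hvV, hdV, hv, hdv, hq, hp, hpc, hsum⟩ := exists_primitive_relation hV
    by_cases hm : k ≤ m
    · exact Or.inl (hlarge hm hv hvV)
    rw [not_le] at hm
    right
    have hpP : p ∈ coeffSet m q := mem_coeffSet.2 ⟨hp, c, hpc⟩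
    have hvA : v ∈ admissibleTuples n p q := by
      refine ⟨hv, fun j => ⟨d j, ?_⟩⟩
      simpa using congrFun hsum j
    obtain hq1 | hq1 : q = 1 ∨ 2 ≤ q := by omega
    · right
      subst hq1
      simp only [Nat.cast_one, one_smul] at hsum
      have hp1 (i) : p i = 1 ∨ p i = -1 := by
        have h1 := (hp i).1
        have h2 := abs_le.1 (hp i).2
        push_cast at h2
        omega
      refine ⟨m, hm, ?_, factorial_le_sum_latticeCount (fun p hp σ => comp_mem_coeffSet hp σ)
        comp_mem_relationSet hpP hvA ⟨fun i => hSO (hvV i), hSO ?_⟩⟩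
      · by_contra h
        obtain rfl | rfl : m = 0 ∨ m = 1 := by omega
        · have hd0 : d = 0 := by simpa using hsum.symm
          refine hS' (f d) hdV ?_
          rw [← hfneg, hd0, neg_zero]
          exact hd0 ▸ hdV
        · rw [Fin.sum_univ_one] at hsum
          obtain h1 | h1 := hp1 0
          · exact hdv ⟨0, by rw [← hsum, h1, one_smul]⟩
          · refine hS' (f d) hdV ?_
            rw [← hfneg, ← hsum, h1, neg_smul, one_smul, neg_neg]
            exact hvV 0
      · have : f d = 0 + ∑ i, p i • tupleMap g (tupleCast v) i := by
          rw [← hsum, zero_add]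
          simp only [f, tupleMap]
          have h1 : (fun j => (((∑ i, p i • v i) j : ℤ) : ℝ)) =
              ∑ i, p i • fun j => (v i j : ℝ) := by
            ext j
            simp
          rw [h1, Matrix.mulVec_sum]
          refine Finset.sum_congr rfl fun i _ => ?_
          rw [← Int.cast_smul_eq_zsmul ℝ, ← Int.cast_smul_eq_zsmul ℝ, Matrix.mulVec_smul]
          rfl
        rw [← this]
        exact hdV
    · left
      exact ⟨m, hm, q, hq1, factorial_le_sum_latticeCount (fun p hp σ => comp_mem_coeffSet hp σ)
        (W := fun _ => {x : Fin m → Fin n → ℝ | ∀ i, x i ∈ O})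
        (fun p x σ hx i => hx _) hpP hvA fun i => hSO (hvV i)⟩

theorem isOpen_relationSet {m n : ℕ} (p : Fin m → ℤ) {O : Set (Fin n → ℝ)} (hO : IsOpen O)
    (w : Fin n → ℝ) : IsOpen (relationSet p O w) := by
  refine IsOpen.and ?_ (hO.preimage (by fun_prop))
  simp only [Set.ofPred_forall]
  exact isOpen_iInter_of_finite fun i => hO.preimage (continuous_apply i)

theorem isOpen_box {m n : ℕ} {O : Set (Fin n → ℝ)} (hO : IsOpen O) :
    IsOpen {x : Fin m → Fin n → ℝ | ∀ i, x i ∈ O} := by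
  simp only [Set.ofPred_forall]
  exact isOpen_iInter_of_finite fun i => hO.preimage (continuous_apply i)

theorem volume_box (m : ℕ) {n : ℕ} (O : Set (Fin n → ℝ)) :
    volume {x : Fin m → Fin n → ℝ | ∀ i, x i ∈ O} = volume O ^ m := by
  have : {x : Fin m → Fin n → ℝ | ∀ i, x i ∈ O} = Set.univ.pi fun _ => O := by
    ext x
    simp
  rw [this, volume_pi_pi]
  simp

/-- First-moment bound for the probability that a sum of counts reaches `m!`. -/
theorem measure_factorial_le_sum_latticeCount {m n q : ℕ} (hmn : 2 * m < n) (hq : q ≠ 0)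
    {P : Finset (Fin m → ℤ)} (hP : ∀ p ∈ P, ∃ c : Fin m → ℤ, (q : ℤ) ∣ ∑ i, p i * c i - 1)
    {W : (Fin m → ℤ) → Set (Fin m → Fin n → ℝ)} (hW : ∀ p, IsOpen (W p)) {b : ℝ}
    (hWb : ∀ p ∈ P, volume (W p) ≤ ENNReal.ofReal b) {N : ℕ} (hN : P.card ≤ N)
    (μ : Measure (LatticeSpace n)) [IsProbabilityMeasure μ]
    (hμ : ∀ g : SLR n, Measure.map (fun x => g • x) μ = μ) :
    μ {x : LatticeSpace n | (m.factorial : ℝ≥0∞) ≤ ∑ p ∈ P, latticeCount (admissibleTuples n p q) (W p)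
      (Quotient.out (α := SLR n) x)} ≤ ENNReal.ofReal (N * (b / q ^ n) / m.factorial) := by
  have hmeas (p : Fin m → ℤ) : Measurable fun x : LatticeSpace n =>
      latticeCount (admissibleTuples n p q) (W p) (Quotient.out (α := SLR n) x) :=
    measurable_latticeSpace_out (measurable_latticeCount _ (hW p).measurableSet)
      fun g γ hγ => latticeCount_mul (W p) g γ hγ
  have hm : (0 : ℝ) < m.factorial := by exact_mod_cast m.factorial_pos
  have hq' : (0 : ℝ) < (q : ℝ) ^ n := by positivity
  refine (meas_ge_le_lintegral_div (Finset.measurable_fun_sum P fun p _ => hmeas p).aemeasurable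
    (by exact_mod_cast m.factorial_ne_zero) (ENNReal.natCast_ne_top _)).trans ?_
  rw [lintegral_finsetSum _ fun p _ => hmeas p, ENNReal.ofReal_div_of_pos hm, ENNReal.ofReal_natCast]
  refine ENNReal.div_le_div_right ?_ _
  rw [ENNReal.ofReal_mul (Nat.cast_nonneg _), ENNReal.ofReal_natCast, ENNReal.ofReal_div_of_pos hq',
    ENNReal.ofReal_pow (Nat.cast_nonneg _), ENNReal.ofReal_natCast]
  calc _ ≤ ∑ p ∈ P, ENNReal.ofReal b / (q : ℝ≥0∞) ^ n := by
        refine Finset.sum_le_sum fun p hp => ?_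
        obtain ⟨c, hc⟩ := hP p hp
        refine (lintegral_latticeCount_le hmn hq hc (hW p) μ hμ).trans ?_
        exact ENNReal.div_le_div_right (hWb p hp) _
    _ ≤ _ := by
        rw [Finset.sum_const, nsmul_eq_mul]
        gcongr

theorem exp_le_exp_neg_of_le {x a : ℝ} {n : ℕ} (h : x = a * n) (ha : a ≤ -(1 / 200)) :
    Real.exp x ≤ Real.exp (-(1 / 200 * n)) := by
  rw [Real.exp_le_exp, h]
  have : (0 : ℝ) ≤ n := Nat.cast_nonneg _
  nlinarith

theorem volume_box_le (m : ℕ) {n : ℕ} {O : Set (Fin n → ℝ)}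
    (hv : volume O ≤ ENNReal.ofReal ((n : ℝ) / 29)) :
    volume {x : Fin m → Fin n → ℝ | ∀ i, x i ∈ O} ≤ ENNReal.ofReal (((n : ℝ) / 29) ^ m) := by
  rw [volume_box, ENNReal.ofReal_pow (by positivity)]
  gcongr

theorem measure_many_le {n k : ℕ} (hk : 2 * k < n) (hnk : (n : ℝ) / 10 ≤ k) {O : Set (Fin n → ℝ)}
    (hO : IsOpen O) (hv : volume O ≤ ENNReal.ofReal ((n : ℝ) / 29))
    (μ : Measure (LatticeSpace n)) [IsProbabilityMeasure μ]
    (hμ : ∀ g : SLR n, Measure.map (fun x => g • x) μ = μ) :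
    μ {x : LatticeSpace n | (k.factorial : ℝ≥0∞) ≤ latticeCount (admissibleTuples n (0 : Fin k → ℤ) 1)
      {x | ∀ i, x i ∈ O} (Quotient.out (α := SLR n) x)} ≤
      ENNReal.ofReal (Real.exp (-(1 / 200 * n))) := by
  have h := measure_factorial_le_sum_latticeCount (q := 1) (P := {0}) (N := 1)
    (W := fun _ => {x : Fin k → Fin n → ℝ | ∀ i, x i ∈ O}) hk one_ne_zero
    (by simp) (fun _ => isOpen_box hO) (fun _ _ => volume_box_le k hv) (by simp) μ hμ
  simp only [Finset.sum_singleton] at h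
  refine h.trans (ENNReal.ofReal_le_ofReal ?_)
  have h1 := Real.pow_div_factorial_le_exp (Real.exp 1 * (n / 29)) (by positivity) k
  rw [mul_pow, ← Real.exp_nat_mul, mul_one, mul_div_assoc, mul_comm, ← le_div_iff₀ (Real.exp_pos _),
    ← Real.exp_sub] at h1
  simp only [Nat.cast_one, one_pow, div_one, one_mul]
  refine h1.trans ((Real.exp_le_exp.2 (sub_le_sub_left hnk _)).trans ?_)
  refine exp_le_exp_neg_of_le (a := Real.exp 1 / 29 - 1 / 10) (by ring) ?_
  linarith [Real.exp_one_lt_d9]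

theorem measure_large_coeff_le :
    ∃ K : ℝ, 0 < K ∧ ∀ {n k : ℕ}, 2 * k < n → ∀ {O : Set (Fin n → ℝ)},
    IsOpen O → volume O ≤ ENNReal.ofReal ((n : ℝ) / 29) →
    ∀ (μ : Measure (LatticeSpace n)) [IsProbabilityMeasure μ],
    (∀ g : SLR n, Measure.map (fun x => g • x) μ = μ) →
    μ {x : LatticeSpace n | ∃ m < k, ∃ q, 2 ≤ q ∧ (m.factorial : ℝ≥0∞) ≤
      ∑ p ∈ coeffSet m q, latticeCount (admissibleTuples n p q) {x | ∀ i, x i ∈ O}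
        (Quotient.out (α := SLR n) x)} ≤
      ENNReal.ofReal (K * Real.exp (-(1 / 200 * n))) := by
  have hsum : Summable fun r : ℕ => 1 / ((r + 2 : ℕ) : ℝ) ^ 2 :=
    (summable_nat_add_iff 2).2 (Real.summable_one_div_nat_pow.2 one_lt_two)
  set T := ∑' r : ℕ, 1 / ((r + 2 : ℕ) : ℝ) ^ 2 with hT
  have hTpos : 0 < T := hsum.tsum_pos (fun _ => by positivity) 0 (by norm_num)
  refine ⟨4 * T, by positivity, ?_⟩
  intro n k hk O hO hv μ _ hμ
  have hsub : {x : LatticeSpace n | ∃ m < k, ∃ q, 2 ≤ q ∧ (m.factorial : ℝ≥0∞) ≤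
      ∑ p ∈ coeffSet m q, latticeCount (admissibleTuples n p q) {x | ∀ i, x i ∈ O}
        (Quotient.out (α := SLR n) x)} ⊆ ⋃ m ∈ Finset.range k, ⋃ r : ℕ,
      {x : LatticeSpace n | (m.factorial : ℝ≥0∞) ≤ ∑ p ∈ coeffSet m (r + 2),
        latticeCount (admissibleTuples n p (r + 2)) {x | ∀ i, x i ∈ O}
        (Quotient.out (α := SLR n) x)} := by
    rintro x ⟨m, hm, q, hq, h⟩
    obtain ⟨r, rfl⟩ := Nat.exists_eq_add_of_le' hq
    simp only [Set.mem_iUnion]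
    exact ⟨m, Finset.mem_range.2 hm, r, h⟩
  have hterm (m : ℕ) (hm : m < k) (r : ℕ) :
      μ {x : LatticeSpace n | (m.factorial : ℝ≥0∞) ≤ ∑ p ∈ coeffSet m (r + 2),
        latticeCount (admissibleTuples n p (r + 2)) {x | ∀ i, x i ∈ O}
        (Quotient.out (α := SLR n) x)} ≤
      ENNReal.ofReal ((4 * (n / 29 : ℝ)) ^ m / m.factorial * (4 * 2⁻¹ ^ n) *
        (1 / ((r + 2 : ℕ) : ℝ) ^ 2)) := by
    refine (measure_factorial_le_sum_latticeCount (by omega) (by omega)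
      (fun p hp => (mem_coeffSet.1 hp).2) (fun _ => isOpen_box hO) (fun _ _ => volume_box_le m hv)
      (card_coeffSet_le m (r + 2)) μ hμ).trans (ENNReal.ofReal_le_ofReal ?_)
    obtain ⟨j, rfl⟩ : ∃ j, n = m + 2 + j := Nat.exists_eq_add_of_le (by omega)
    generalize hQ : r + 2 = Q
    have hQ2 : (2 : ℝ) ≤ Q := by
      rw [← hQ]; push_cast; linarith [(Nat.cast_nonneg r : (0 : ℝ) ≤ r)]
    have hj : ((Q : ℝ) ^ j)⁻¹ ≤ 2⁻¹ ^ j := by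
      rw [← inv_pow]; gcongr
    have hv0 : (0 : ℝ) ≤ ((m + 2 + j : ℕ) : ℝ) / 29 := by positivity
    generalize ((m + 2 + j : ℕ) : ℝ) / 29 = v at *
    have hQ0 : (Q : ℝ) ≠ 0 := by positivity
    calc _ = (2 * v) ^ m / m.factorial * (1 / Q ^ 2) * ((Q : ℝ) ^ j)⁻¹ := by
          push_cast
          rw [mul_pow, mul_pow, pow_add, pow_add]
          field_simp
      _ ≤ (2 * v) ^ m / m.factorial * (1 / Q ^ 2) * 2⁻¹ ^ j := by
          gcongr
      _ = _ := by
          rw [pow_add, pow_add, show (4 : ℝ) * v = 2 * (2 * v) by ring, mul_pow 2 (2 * v), inv_pow,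
            inv_pow]
          field_simp
          ring
  refine (measure_mono hsub).trans ((measure_biUnion_finset_le _ _).trans ?_)
  calc _ ≤ ∑ m ∈ Finset.range k, ENNReal.ofReal ((4 * (n / 29 : ℝ)) ^ m / m.factorial *
        (4 * 2⁻¹ ^ n) * T) := by
        refine Finset.sum_le_sum fun m hm => (measure_iUnion_le _).trans ?_
        refine (ENNReal.tsum_le_tsum (hterm m (Finset.mem_range.1 hm))).trans ?_
        rw [← ENNReal.ofReal_tsum_of_nonneg (fun _ => by positivity) (hsum.mul_left _),
          tsum_mul_left]
    _ ≤ _ := by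
        rw [← ENNReal.ofReal_sum_of_nonneg fun _ _ => by positivity]
        refine ENNReal.ofReal_le_ofReal ?_
        rw [← Finset.sum_mul, ← Finset.sum_mul]
        have h1 := Real.sum_le_exp_of_nonneg (x := 4 * (n / 29 : ℝ)) (by positivity) k
        have h2 : (2⁻¹ : ℝ) ^ n = Real.exp (-(Real.log 2 * n)) := by
          rw [← Real.exp_log (x := 2⁻¹) (by norm_num), ← Real.exp_nat_mul, Real.log_inv]
          ring_nf
        have h3 : Real.exp (4 * (n / 29)) * Real.exp (-(Real.log 2 * n)) ≤
            Real.exp (-(1 / 200 * n)) := by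
          rw [← Real.exp_add]
          refine exp_le_exp_neg_of_le (a := 4 / 29 - Real.log 2) (by ring) ?_
          linarith [Real.log_two_gt_d9]
        calc _ ≤ Real.exp (4 * (n / 29)) * (4 * 2⁻¹ ^ n) * T := by gcongr
          _ = 4 * T * (Real.exp (4 * (n / 29)) * Real.exp (-(Real.log 2 * n))) := by
              rw [h2]; ring
          _ ≤ _ := by gcongr

theorem pow_le_exp_neg (n : ℕ) : (24 / 25 : ℝ) ^ n ≤ Real.exp (-(1 / 25 * n)) := by
  have h := Real.one_sub_le_exp_neg (1 / 25)
  calc (24 / 25 : ℝ) ^ n ≤ Real.exp (-(1 / 25)) ^ n := by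
        gcongr
        linarith
    _ = _ := by
        rw [← Real.exp_nat_mul]
        ring_nf

theorem eq_one_or_of_mem_coeffSet_one {m : ℕ} {p : Fin m → ℤ} (hp : p ∈ coeffSet m 1) (i : Fin m) :
    p i = 1 ∨ p i = -1 := by
  have h := (mem_coeffSet.1 hp).1 i
  have h1 := h.1
  have h2 := abs_le.1 h.2
  push_cast at h2
  omega

theorem measure_relation_le {n k : ℕ} (hk : 2 * k < n) {O : Set (Fin n → ℝ)}
    (hO : IsOpen O) (hv : volume O ≤ ENNReal.ofReal ((n : ℝ) / 29))
    (μ : Measure (LatticeSpace n)) [IsProbabilityMeasure μ]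
    (hμ : ∀ g : SLR n, Measure.map (fun x => g • x) μ = μ) :
    μ {x : LatticeSpace n | ∃ m < k, 2 ≤ m ∧ (m.factorial : ℝ≥0∞) ≤
      ∑ p ∈ coeffSet m 1, latticeCount (admissibleTuples n p 1) (relationSet p O 0)
        (Quotient.out (α := SLR n) x)} ≤
      ENNReal.ofReal (5 * Real.exp (-(1 / 200 * n))) := by
  let E (m : ℕ) : Set (LatticeSpace n) := {x : LatticeSpace n | (m.factorial : ℝ≥0∞) ≤
      ∑ p ∈ coeffSet m 1, latticeCount (admissibleTuples n p 1) (relationSet p O 0)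
        (Quotient.out (α := SLR n) x)}
  have hOv : volume O ≠ ∞ := (hv.trans_lt ENNReal.ofReal_lt_top).ne
  have hvp (m : ℕ) : volume O ^ m ≤ ENNReal.ofReal ((n / 29 : ℝ) ^ m) := by
    rw [ENNReal.ofReal_pow (by positivity)]
    gcongr
  have hterm {m : ℕ} (hm : m < k) {b : ℝ}
      (hb : ∀ p ∈ coeffSet m 1, volume (relationSet p O 0) ≤ ENNReal.ofReal b) :
      μ (E m) ≤ ENNReal.ofReal (2 ^ m * b / m.factorial) := by
    refine (measure_factorial_le_sum_latticeCount (by omega) one_ne_zero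
      (fun p hp => (mem_coeffSet.1 hp).2) (fun _ => isOpen_relationSet _ hO 0) hb
      (card_coeffSet_le m 1) μ hμ).trans (ENNReal.ofReal_le_ofReal ?_)
    simp
  have hE2 (hm : 2 < k) : μ (E 2) ≤ ENNReal.ofReal (4 * Real.exp (-(1 / 200 * n))) := by
    refine (hterm hm (b := (24 / 25) ^ n * (n / 29 : ℝ) ^ 2) fun p hp => ?_).trans
      (ENNReal.ofReal_le_ofReal ?_)
    · refine (volume_relationSet_two_le (eq_one_or_of_mem_coeffSet_one hp) hO.measurableSet 0).trans ?_
      rw [ENNReal.ofReal_mul (by positivity), ENNReal.ofReal_pow (by norm_num)]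
      gcongr
      exact hvp 2
    · have h1 := Real.pow_div_factorial_le_exp (n / 29 : ℝ) (by positivity) 2
      calc _ = 4 * ((n / 29 : ℝ) ^ 2 / (2 : ℕ).factorial * (24 / 25) ^ n) := by ring
        _ ≤ 4 * (Real.exp (n / 29 : ℝ) * Real.exp (-(1 / 25 * n))) := by
            gcongr
            exact pow_le_exp_neg n
        _ ≤ _ := by
            rw [← Real.exp_add]
            gcongr 4 * ?_
            exact exp_le_exp_neg_of_le (a := 1 / 29 - 1 / 25) (by ring) (by norm_num)
  have hE3 (m : ℕ) (hm : m < k) (hm3 : 3 ≤ m) :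
      μ (E m) ≤ ENNReal.ofReal ((2 * (n / 29 : ℝ)) ^ m / m.factorial * ((24 / 25) ^ n) ^ 2) := by
    refine (hterm hm (b := ((24 / 25) ^ n) ^ 2 * (n / 29 : ℝ) ^ m) fun p hp => ?_).trans
      (ENNReal.ofReal_le_ofReal ?_)
    · refine (volume_relationSet_le hm3 (eq_one_or_of_mem_coeffSet_one hp) hO.measurableSet
        hOv 0).trans ?_
      rw [ENNReal.ofReal_mul (by positivity), ENNReal.ofReal_pow (by positivity),
        ENNReal.ofReal_pow (by norm_num)]
      gcongr
      exact hvp m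
    · rw [mul_pow]
      apply le_of_eq
      ring
  have hsub : {x : LatticeSpace n | ∃ m < k, 2 ≤ m ∧ (m.factorial : ℝ≥0∞) ≤
      ∑ p ∈ coeffSet m 1, latticeCount (admissibleTuples n p 1) (relationSet p O 0)
        (Quotient.out (α := SLR n) x)} ⊆
      {x : LatticeSpace n | 2 < k ∧ x ∈ E 2} ∪ ⋃ m ∈ (Finset.range k).filter (3 ≤ ·), E m := by
    rintro x ⟨m, hm, hm2, h⟩
    obtain rfl | hm3 := hm2.eq_or_lt
    · exact Or.inl ⟨hm, h⟩
    · right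
      exact Set.mem_biUnion (Finset.mem_filter.2 ⟨Finset.mem_range.2 hm, hm3⟩) h
  refine (measure_mono hsub).trans ((measure_union_le _ _).trans ?_)
  rw [show (5 : ℝ) * Real.exp (-(1 / 200 * n)) =
    4 * Real.exp (-(1 / 200 * n)) + Real.exp (-(1 / 200 * n)) by ring,
    ENNReal.ofReal_add (by positivity) (by positivity)]
  refine add_le_add ?_ ((measure_biUnion_finset_le _ _).trans ?_)
  · by_cases h2 : 2 < k
    · exact (measure_mono fun x hx => hx.2).trans (hE2 h2)
    · exact (measure_mono_null (fun x hx => h2 hx.1) measure_empty).trans_le zero_le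
  calc _ ≤ ∑ m ∈ (Finset.range k).filter (3 ≤ ·),
        ENNReal.ofReal ((2 * (n / 29 : ℝ)) ^ m / m.factorial * ((24 / 25) ^ n) ^ 2) := by
        refine Finset.sum_le_sum fun m hm => ?_
        rw [Finset.mem_filter, Finset.mem_range] at hm
        exact hE3 m hm.1 hm.2
    _ ≤ ∑ m ∈ Finset.range k,
        ENNReal.ofReal ((2 * (n / 29 : ℝ)) ^ m / m.factorial * ((24 / 25) ^ n) ^ 2) :=
        Finset.sum_le_sum_of_subset (Finset.filter_subset _ _)
    _ ≤ _ := by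
        rw [← ENNReal.ofReal_sum_of_nonneg fun _ _ => by positivity, ← Finset.sum_mul]
        refine ENNReal.ofReal_le_ofReal ?_
        have h1 := Real.sum_le_exp_of_nonneg (x := 2 * (n / 29 : ℝ)) (by positivity) k
        calc _ ≤ Real.exp (2 * (n / 29 : ℝ)) * Real.exp (-(1 / 25 * n)) ^ 2 := by
              gcongr
              exact pow_le_exp_neg n
          _ ≤ _ := by
              rw [← Real.exp_nat_mul, ← Real.exp_add]
              exact exp_le_exp_neg_of_le (a := 2 / 29 - 2 / 25) (by push_cast; ring) (by norm_num)

/-- **Proposition 2.1 (Kim).** There are universal constants `c, C > 0` such that if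
`S ⊆ ℝⁿ` is a Borel set with `S ∩ (-S) = ∅` and `0 < Vol(S) ≤ n/30`, and `μ` is an
`SL(n,ℝ)`-invariant Borel probability measure on the space of covolume-one lattices,
then with probability at least `1 - C e^{-cn}` the set `L ∩ S` is finite, has at most
`n/10` elements, and consists of linearly independent vectors. -/
theorem random_lattice_points_linearly_independent :
    ∃ c C : ℝ, 0 < c ∧ 0 < C ∧
      ∀ n : ℕ, 1 ≤ n →
      ∀ S : Set (Fin n → ℝ), MeasurableSet S → S ∩ (-S) = ∅ →
        0 < volume S → volume S ≤ ENNReal.ofReal ((n : ℝ) / 30) →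
      ∀ μ : Measure (LatticeSpace n), IsProbabilityMeasure μ →
        (∀ g : SLR n, Measure.map (fun x => g • x) μ = μ) →
        1 - C * Real.exp (-(c * n)) ≤
          (μ {L : LatticeSpace n | (latticeOf L ∩ S).Finite ∧
              ((latticeOf L ∩ S).ncard : ℝ) ≤ (n : ℝ) / 10 ∧
              indepSet (latticeOf L ∩ S)}).toReal := by
  obtain ⟨K, hK, hlarge⟩ := measure_large_coeff_le
  refine ⟨1 / 200, K + 6, by norm_num, by positivity, ?_⟩
  intro n hn S _ hS _ hv μ _ hμ
  by_cases hn3 : n < 3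
  · refine le_trans ?_ ENNReal.toReal_nonneg
    have h1 : (n : ℝ) ≤ 2 := by exact_mod_cast Nat.lt_succ_iff.1 hn3
    have h2 := Real.one_sub_le_exp_neg (1 / 200 * (n : ℝ))
    nlinarith [Real.exp_pos (-(1 / 200 * (n : ℝ)))]
  have hn0 : (0 : ℝ) < n := by exact_mod_cast hn
  obtain ⟨O, hSO, hO, hOv⟩ := Set.exists_isOpen_lt_of_lt S (ENNReal.ofReal ((n : ℝ) / 29))
    (hv.trans_lt ((ENNReal.ofReal_lt_ofReal_iff (by positivity)).2 (by linarith)))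
  have hk : 2 * (n / 10 + 1) < n := by omega
  have hnk : (n : ℝ) / 10 ≤ ((n / 10 + 1 : ℕ) : ℝ) := by
    have h : n ≤ 10 * (n / 10 + 1) := by omega
    have : (n : ℝ) ≤ 10 * ((n / 10 + 1 : ℕ) : ℝ) := by exact_mod_cast h
    linarith
  set e := Real.exp (-(1 / 200 * n)) with he
  set good := {L : LatticeSpace n | (latticeOf L ∩ S).Finite ∧
              ((latticeOf L ∩ S).ncard : ℝ) ≤ (n : ℝ) / 10 ∧ indepSet (latticeOf L ∩ S)}
  have h1 := measure_many_le hk hnk hO hOv.le μ hμ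
  have h2 := hlarge hk hO hOv.le μ hμ
  have h3 := measure_relation_le hk hO hOv.le μ hμ
  have htotal : 1 ≤ μ good + ENNReal.ofReal ((K + 6) * e) := by
    rw [show (K + 6) * e = e + (K * e + 5 * e) by ring, ENNReal.ofReal_add (by positivity)
      (by positivity), ENNReal.ofReal_add (by positivity) (by positivity)]
    refine le_trans ?_ (add_le_add le_rfl (add_le_add h1 (add_le_add h2 h3)))
    refine le_trans ?_ (add_le_add le_rfl (add_le_add le_rfl (measure_union_le _ _)))
    refine le_trans ?_ (add_le_add le_rfl (measure_union_le _ _))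
    refine le_trans ?_ (measure_union_le _ _)
    rw [← measure_univ (μ := μ)]
    refine measure_mono fun L _ => ?_
    obtain ⟨ha, hb, hc⟩ | h | h | h :=
      indepSet_or_factorial_le hSO hS (Quotient.out (α := SLR n) L) (k := n / 10 + 1)
      (X := latticeOf L ∩ S) rfl
    · refine Or.inl ⟨ha, ?_, hc⟩
      rw [le_div_iff₀ (by norm_num)]
      have h : (latticeOf L ∩ S).ncard * 10 ≤ n := by omega
      exact_mod_cast h
    · exact Or.inr (Or.inl h)
    · exact Or.inr (Or.inr (Or.inl h))
    · exact Or.inr (Or.inr (Or.inr h))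
  have h4 := ENNReal.toReal_mono (ENNReal.add_ne_top.2 ⟨measure_ne_top μ good,
    ENNReal.ofReal_ne_top⟩) htotal
  rw [ENNReal.toReal_add (measure_ne_top _ _) ENNReal.ofReal_ne_top, ENNReal.toReal_one,
    ENNReal.toReal_ofReal (by positivity)] at h4
  linarith
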